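/- arXiv:2311.12697 — 2 statements merged into one kernel-verified Lean document; each statement's English description precedes it below -/
import Mathlib

section
/- Let Λ = A_{n,m} with n > 1, m ≥ n. If n divides m (i.e., s₁ = 0 with m = k₀ n), then every indecomposable non-projective Λ-module X of length t satisfies: Ext^{2i}_Λ(X,X) ≠ 0 for all i ≥ 1, so rd(X) ≤ 1. -/
open CategoryTheory CategoryTheory.Limits Opposite

universe u

namespace Rigidity

variable (Λ : Type u) [Ring Λ]

/-- `X` belongs to `add M`: it is a direct summand of a finite direct sum of copies of `M`. -/
def InAdd (M X : ModuleCat.{u} Λ) : Prop :=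
  ∃ (r : ℕ) (Y : ModuleCat.{u} Λ), Nonempty ((X ⊞ Y) ≅ ⨁ (fun _ : Fin r => M))

/-- An indecomposable object. -/
def Indec (X : ModuleCat.{u} Λ) : Prop :=
  ¬ IsZero X ∧ ∀ A B : ModuleCat.{u} Λ, Nonempty (X ≅ A ⊞ B) → IsZero A ∨ IsZero B

/-- A generator-cogenerator: `add M` contains the regular module and all
finitely generated injective modules. -/
def IsGenCogen (M : ModuleCat.{u} Λ) : Prop :=
  InAdd Λ M (ModuleCat.of Λ Λ) ∧
  ∀ I : ModuleCat.{u} Λ, Module.Finite Λ I → Injective I → InAdd Λ M I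

/-- `g : A ⟶ X` is a right minimal `add M`-approximation. -/
def IsRMApprox (M : ModuleCat.{u} Λ) {A X : ModuleCat.{u} Λ} (g : A ⟶ X) : Prop :=
  InAdd Λ M A ∧
  (∀ T : ModuleCat.{u} Λ, InAdd Λ M T → ∀ f : T ⟶ X, ∃ h : T ⟶ A, h ≫ g = f) ∧
  (∀ h : A ⟶ A, h ≫ g = g → IsIso h)

/-- `IsMSyzygy M X r W` : `W` is an `r`-th `M`-syzygy `Ω_M^r(X)` of `X`. -/
inductive IsMSyzygy (M : ModuleCat.{u} Λ) : ModuleCat.{u} Λ → ℕ → ModuleCat.{u} Λ → Prop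
  | zero (X : ModuleCat.{u} Λ) : IsMSyzygy M X 0 X
  | succ (X : ModuleCat.{u} Λ) (r : ℕ) (W A : ModuleCat.{u} Λ) (g : A ⟶ W)
      (hW : IsMSyzygy M X r W) (hg : IsRMApprox Λ M g) :
      IsMSyzygy M X (r + 1) (kernel g)

/-- The `M`-dimension of `X` is at most `r`. -/
def MdimLE (M X : ModuleCat.{u} Λ) (r : ℕ) : Prop :=
  ∃ W : ModuleCat.{u} Λ, IsMSyzygy Λ M X r W ∧ InAdd Λ M W

/-- projective dimension at most `r`, via a length `r` projective resolution. -/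
def ProjDimLE (A : Type u) [Ring A] (N : ModuleCat.{u} A) (r : ℕ) : Prop :=
  ∃ (P : ℕ → ModuleCat.{u} A) (d : ∀ i : ℕ, P (i + 1) ⟶ P i) (f : P 0 ⟶ N),
    (∀ i, Projective (P i)) ∧ (∀ i, r < i → IsZero (P i)) ∧ Epi f ∧
    (∃ w : d 0 ≫ f = 0, (ShortComplex.mk (d 0) f w).Exact) ∧
    (∀ i, ∃ w : d (i + 1) ≫ d i = 0, (ShortComplex.mk (d (i + 1)) (d i) w).Exact)

/-- global dimension at most `r`. -/
def GldimLE (A : Type u) [Ring A] (r : ℕ) : Prop :=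
  ∀ N : ModuleCat.{u} A, ProjDimLE A N r

/-- the global dimension, as an element of `ℕ∞`. -/
noncomputable def gldim (A : Type u) [Ring A] : ℕ∞ :=
  sInf {c : ℕ∞ | ∃ r : ℕ, c = (r : ℕ∞) ∧ GldimLE A r}

/-- dominant dimension at least `r`: there is an exact sequence
`0 → A → I^0 → ⋯ → I^(r-1)` with all `I^i` projective-injective. -/
def DomdimGE (A : Type u) [Ring A] (r : ℕ) : Prop :=
  ∃ (I : ℕ → ModuleCat.{u} A) (f : ModuleCat.of A A ⟶ I 0) (g : ∀ i : ℕ, I i ⟶ I (i + 1)),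
    Mono f ∧ (∀ i, i < r → Injective (I i) ∧ Projective (I i)) ∧
    (2 ≤ r → ∃ w : f ≫ g 0 = 0, (ShortComplex.mk f (g 0) w).Exact) ∧
    (∀ i, i + 3 ≤ r → ∃ w : g i ≫ g (i + 1) = 0, (ShortComplex.mk (g i) (g (i + 1)) w).Exact)

/-- the dominant dimension, as an element of `ℕ∞`. -/
noncomputable def domdim (A : Type u) [Ring A] : ℕ∞ :=
  sSup {c : ℕ∞ | ∃ r : ℕ, c = (r : ℕ∞) ∧ DomdimGE A r}

/-- the rigidity degree of a module, as an element of `ℕ∞`. -/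
noncomputable def rigDeg [HasExt.{u} (ModuleCat.{u} Λ)] (M : ModuleCat.{u} Λ) : ℕ∞ :=
  sSup {c : ℕ∞ | ∃ r : ℕ, c = (r : ℕ∞) ∧ 0 < r ∧
    ∀ i : ℕ, 1 ≤ i → i ≤ r → Subsingleton (Abelian.Ext M M i)}

/-- the rigidity dimension. -/
noncomputable def rigdim : ℕ∞ :=
  sSup {c : ℕ∞ | ∃ M : ModuleCat.{u} Λ, Module.Finite Λ M ∧ IsGenCogen Λ M ∧
    (∃ r : ℕ, GldimLE (End (op M)) r) ∧ c = domdim (End (op M))}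

/-- An Auslander-Reiten (almost split) sequence. -/
def IsARSeq {X Y Z : ModuleCat.{u} Λ} (f : X ⟶ Y) (g : Y ⟶ Z) : Prop :=
  Mono f ∧ Epi g ∧ (∃ w : f ≫ g = 0, (ShortComplex.mk f g w).Exact) ∧
  Indec Λ X ∧ Indec Λ Z ∧
  (¬ ∃ s : Z ⟶ Y, s ≫ g = 𝟙 Z) ∧
  (∀ (W : ModuleCat.{u} Λ) (h : W ⟶ Z), (¬ ∃ s : Z ⟶ W, s ≫ h = 𝟙 Z) →
    ∃ h' : W ⟶ Y, h' ≫ g = h)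

/-- `X` has composition length `t`. -/
def HasCompLength (X : ModuleCat.{u} Λ) (t : ℕ) : Prop :=
  (∃ c : Fin (t + 1) → Submodule Λ X, StrictMono c ∧ c 0 = ⊥ ∧ c (Fin.last t) = ⊤) ∧
  ∀ r : ℕ, (∃ c : Fin (r + 1) → Submodule Λ X, StrictMono c ∧ c 0 = ⊥ ∧ c (Fin.last r) = ⊤) →
    r ≤ t


/-- powers of the Jacobson radical, as left submodules of `Λ`. -/
def radPow (Λ : Type u) [Ring Λ] : ℕ → Submodule Λ Λ
  | 0 => ⊤
  | r + 1 => Submodule.span Λ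
      {x : Λ | ∃ a ∈ Ideal.jacobson (⊥ : Ideal Λ), ∃ b ∈ radPow Λ r, x = a * b}

/-- `Λ` is the connected self-injective Nakayama algebra over `k`
with `n` simple modules and Loewy length `m`. -/
structure IsSelfInjNakayama (k : Type u) (Λ : Type u) [Field k] [Ring Λ] [Algebra k Λ]
    (n m : ℕ) : Prop where
  findim : FiniteDimensional k Λ
  connected : ∀ e : Λ, IsIdempotentElem e → e ∈ Set.center Λ → e = 0 ∨ e = 1
  selfinj : Injective (ModuleCat.of Λ Λ)
  uniserial : ∀ X : ModuleCat.{u} Λ, Module.Finite Λ X → Indec Λ X →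
    ∀ N₁ N₂ : Submodule Λ X, N₁ ≤ N₂ ∨ N₂ ≤ N₁
  simples : ∃ S : Fin n → ModuleCat.{u} Λ, (∀ i, IsSimpleModule Λ (S i)) ∧
    (∀ i j, Nonempty (S i ≅ S j) → i = j) ∧
    ∀ T : ModuleCat.{u} Λ, IsSimpleModule Λ T → ∃ i, Nonempty (T ≅ S i)
  loewy_top : radPow Λ m = ⊥
  loewy_bot : radPow Λ (m - 1) ≠ ⊥

section Uniserial

variable {Λ}
variable {M N : Type u} [AddCommGroup M] [Module Λ M] [AddCommGroup N] [Module Λ N]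

/-- The submodules of `M` form a chain. -/
def IsUniserial (Λ : Type u) [Ring Λ] (M : Type u) [AddCommGroup M] [Module Λ M] : Prop :=
  ∀ N₁ N₂ : Submodule Λ M, N₁ ≤ N₂ ∨ N₂ ≤ N₁

/-- The radical series of `M`: its `t`-th term is the `t`-th radical power applied to `M`. -/
def radSeries (Λ : Type u) [Ring Λ] (M : Type u) [AddCommGroup M] [Module Λ M] (t : ℕ) :
    Submodule Λ M :=
  (fun K : Submodule Λ M => Ring.jacobson Λ • K)^[t] ⊤

@[simp] lemma radSeries_zero : radSeries Λ M 0 = ⊤ := rfl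

lemma radSeries_succ (t : ℕ) : radSeries Λ M (t + 1) = Ring.jacobson Λ • radSeries Λ M t :=
  Function.iterate_succ_apply' _ _ _

lemma radSeries_antitone : Antitone (radSeries Λ M) :=
  antitone_nat_of_succ_le fun t => by
    rw [radSeries_succ]
    exact Submodule.smul_le_right

lemma map_radSeries {f : M →ₗ[Λ] N} (hf : Function.Surjective f) (t : ℕ) :
    (radSeries Λ M t).map f = radSeries Λ N t := by
  induction t with
  | zero => simpa using LinearMap.range_eq_top.2 hf
  | succ t ih => rw [radSeries_succ, Submodule.map_smul'', ih, radSeries_succ]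

lemma map_subtype_radSeries (t s : ℕ) :
    (radSeries Λ (radSeries Λ M t) s).map (radSeries Λ M t).subtype = radSeries Λ M (t + s) := by
  induction s with
  | zero => simp
  | succ s ih => rw [radSeries_succ, Submodule.map_smul'', ih, ← add_assoc, radSeries_succ]

lemma radSeries_radSeries_eq_bot_iff (t s : ℕ) :
    radSeries Λ (radSeries Λ M t) s = ⊥ ↔ radSeries Λ M (t + s) = ⊥ := by
  rw [← map_subtype_radSeries, ← LinearMap.le_ker_iff_map, Submodule.ker_subtype, le_bot_iff]

lemma radSeries_eq_bot_of_surjective {f : M →ₗ[Λ] N} (hf : Function.Surjective f) {t : ℕ}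
    (h : radSeries Λ M t = ⊥) : radSeries Λ N t = ⊥ := by
  rw [← map_radSeries hf, h, Submodule.map_bot]

lemma map_radSeries_le (f : M →ₗ[Λ] N) (t : ℕ) : (radSeries Λ M t).map f ≤ radSeries Λ N t := by
  induction t with
  | zero => simp
  | succ t ih =>
    rw [radSeries_succ, radSeries_succ, Submodule.map_smul'']
    exact smul_mono_right _ ih

lemma radSeries_eq_bot_of_injective {f : M →ₗ[Λ] N} (hf : Function.Injective f) {t : ℕ}
    (h : radSeries Λ N t = ⊥) : radSeries Λ M t = ⊥ := by
  have key := map_radSeries_le f t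
  rwa [h, le_bot_iff, ← LinearMap.le_ker_iff_map, LinearMap.ker_eq_bot.2 hf, le_bot_iff] at key

/-- A surjection `M → N` restricts to a surjection between the terms of the radical series. -/
lemma exists_radSeries_surjective {f : M →ₗ[Λ] N} (hf : Function.Surjective f) (t : ℕ) :
    ∃ g : radSeries Λ M t →ₗ[Λ] radSeries Λ N t, Function.Surjective g := by
  refine ⟨f.restrict fun x hx => ?_, ?_⟩
  · rw [← map_radSeries hf]
    exact Submodule.mem_map_of_mem hx
  · rintro ⟨y, hy⟩
    rw [← map_radSeries hf] at hy
    obtain ⟨x, hx, rfl⟩ := hy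
    exact ⟨⟨x, hx⟩, rfl⟩

lemma exists_radSeries_add_surjective (t s : ℕ) :
    ∃ g : radSeries Λ (radSeries Λ M t) s →ₗ[Λ] radSeries Λ M (t + s),
      Function.Surjective g := by
  refine ⟨(radSeries Λ M t).subtype.restrict fun x hx => ?_, ?_⟩
  · rw [← map_subtype_radSeries]
    exact Submodule.mem_map_of_mem hx
  · rintro ⟨y, hy⟩
    rw [← map_subtype_radSeries] at hy
    obtain ⟨x, hx, rfl⟩ := hy
    exact ⟨⟨x, hx⟩, rfl⟩

lemma IsUniserial.of_surjective (h : IsUniserial Λ M) {f : M →ₗ[Λ] N}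
    (hf : Function.Surjective f) : IsUniserial Λ N := fun N₁ N₂ =>
  (h (N₁.comap f) (N₂.comap f)).imp (Submodule.comap_le_comap_iff_of_surjective hf).1
    (Submodule.comap_le_comap_iff_of_surjective hf).1

lemma IsUniserial.submodule (h : IsUniserial Λ M) (K : Submodule Λ M) : IsUniserial Λ K :=
  fun N₁ N₂ => (h (N₁.map K.subtype) (N₂.map K.subtype)).imp
    (Submodule.map_le_map_iff_of_injective K.subtype_injective _ _).1
    (Submodule.map_le_map_iff_of_injective K.subtype_injective _ _).1

lemma IsUniserial.eq_top_of_sup_eq_top (h : IsUniserial Λ M) {A B : Submodule Λ M}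
    (hAB : A ⊔ B = ⊤) : A = ⊤ ∨ B = ⊤ := by
  rcases h A B with hle | hle
  · exact .inr (by rwa [sup_eq_right.2 hle] at hAB)
  · exact .inl (by rwa [sup_eq_left.2 hle] at hAB)

lemma IsUniserial.eq_of_isCoatom (h : IsUniserial Λ M) {A B : Submodule Λ M}
    (hA : IsCoatom A) (hB : IsCoatom B) : A = B := by
  rcases h A B with hle | hle
  · exact (hA.le_iff_eq hB.1).1 hle |>.symm
  · exact (hB.le_iff_eq hA.1).1 hle

lemma IsUniserial.surjective_of_not_range_le (h : IsUniserial Λ M) {K : Submodule Λ M}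
    (hK : IsCoatom K) {f : N →ₗ[Λ] M} (hf : ¬ LinearMap.range f ≤ K) : Function.Surjective f :=
  LinearMap.range_eq_top.1 (hK.2 _ (lt_of_le_not_ge ((h _ _).resolve_left hf) hf))

/-- In a uniserial module over an Artinian ring, `J • N` is the largest proper submodule of `N`. -/
lemma IsUniserial.le_jacobson_smul [IsArtinianRing Λ] (h : IsUniserial Λ M)
    {K L : Submodule Λ M} (hKL : K < L) : K ≤ Ring.jacobson Λ • L := by
  by_contra hK
  have hJK := (h K (Ring.jacobson Λ • L)).resolve_left hK
  let Q := L ⧸ (Ring.jacobson Λ • (⊤ : Submodule Λ L))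
  have htor : Module.IsTorsionBySet Λ Q (Ring.jacobson Λ) := by
    rintro x ⟨r, hr⟩
    obtain ⟨y, rfl⟩ := Submodule.mkQ_surjective _ x
    change r • Submodule.mkQ _ y = 0
    rw [← map_smul, Submodule.mkQ_apply, Submodule.Quotient.mk_eq_zero]
    exact Submodule.smul_mem_smul hr trivial
  let := htor.module
  have hss : IsSemisimpleModule Λ Q := htor.isSemisimpleModule_iff.1 inferInstance
  have hQ : IsUniserial Λ Q := (h.submodule L).of_surjective (Submodule.mkQ_surjective _)
  let K' : Submodule Λ L := K.comap L.subtype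
  have hmapK : K'.map L.subtype = K := by
    rw [Submodule.map_comap_eq, Submodule.range_subtype, inf_eq_right.2 hKL.le]
  have hle : Ring.jacobson Λ • (⊤ : Submodule Λ L) ≤ K' := by
    rw [← Submodule.map_le_map_iff_of_injective L.subtype_injective, hmapK,
      Submodule.map_smul'', Submodule.map_top, Submodule.range_subtype]
    exact hJK
  obtain ⟨C, hC⟩ := exists_isCompl (K'.map (Submodule.mkQ _) : Submodule Λ Q)
  rcases hQ.eq_top_of_sup_eq_top hC.sup_eq_top with htop | htop
  · have := congrArg (Submodule.comap (Submodule.mkQ _)) htop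
    rw [Submodule.comap_map_mkQ, sup_eq_right.2 hle, Submodule.comap_top] at this
    rw [this, Submodule.map_top, Submodule.range_subtype] at hmapK
    exact hKL.ne hmapK.symm
  · have hbot : (K'.map (Submodule.mkQ _) : Submodule Λ Q) = ⊥ := by
      have := hC.inf_eq_bot
      rwa [htop, inf_top_eq] at this
    rw [← LinearMap.le_ker_iff_map, Submodule.ker_mkQ] at hbot
    apply hK
    have := Submodule.map_mono (f := L.subtype) hbot
    rwa [hmapK, Submodule.map_smul'', Submodule.map_top, Submodule.range_subtype] at this

/-- The kernel of a surjection from a uniserial module is read off from the Loewy length. -/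
lemma IsUniserial.ker_eq_radSeries [IsArtinianRing Λ] (h : IsUniserial Λ M) {f : M →ₗ[Λ] N}
    (hf : Function.Surjective f) {s : ℕ} (hs : radSeries Λ N s = ⊥)
    (hs' : ∀ r, r + 1 = s → radSeries Λ N r ≠ ⊥) : LinearMap.ker f = radSeries Λ M s := by
  apply le_antisymm
  · cases s with
    | zero => simp
    | succ s =>
      have hnle : ¬ radSeries Λ M s ≤ LinearMap.ker f := fun hle => hs' s rfl <| by
        rw [← map_radSeries hf, ← LinearMap.le_ker_iff_map]
        exact hle
      rw [radSeries_succ]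
      refine h.le_jacobson_smul (lt_of_le_not_ge ((h _ _).resolve_left hnle) hnle)
  · rw [LinearMap.le_ker_iff_map, map_radSeries hf, hs]

lemma IsUniserial.exists_eq_radSeries [IsArtinianRing Λ] (h : IsUniserial Λ M)
    {m : ℕ} (hm : radSeries Λ M m = ⊥) (K : Submodule Λ M) : ∃ t, K = radSeries Λ M t := by
  classical
  by_cases hK : K = ⊥
  · exact ⟨m, hK.trans hm.symm⟩
  have hex : ∃ t, ¬ K ≤ radSeries Λ M t := ⟨m, by rwa [hm, le_bot_iff]⟩
  obtain ⟨t, ht⟩ : ∃ t, Nat.find hex = t + 1 :=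
    Nat.exists_eq_succ_of_ne_zero fun h0 => Nat.find_spec hex (by simp [h0])
  have hle : K ≤ radSeries Λ M t := not_not.1 (Nat.find_min hex (by omega))
  have hnle := Nat.find_spec hex
  rw [ht, radSeries_succ] at hnle
  refine ⟨t, by_contra fun hne => hnle (h.le_jacobson_smul (lt_of_le_of_ne hle hne))⟩

end Uniserial

section CoverFamily

variable {Λ}
variable {ι : Type} {P : ι → Submodule Λ Λ}
variable {M N : Type u} [AddCommGroup M] [Module Λ M] [AddCommGroup N] [Module Λ N]

/-- `M` is a quotient of `P i`; for nonzero `M` this says that its top is that of `P i`. -/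
def HasTop (P : ι → Submodule Λ Λ) (M : Type u) [AddCommGroup M] [Module Λ M] (i : ι) : Prop :=
  ∃ f : P i →ₗ[Λ] M, Function.Surjective f

lemma HasTop.of_surjective {i : ι} (h : HasTop P M i) {f : M →ₗ[Λ] N}
    (hf : Function.Surjective f) : HasTop P N i :=
  let ⟨g, hg⟩ := h
  ⟨f.comp g, hf.comp hg⟩

/-- The images in `Λ` of elements of the `P i` with `i ∈ O`. -/
def traceSet (P : ι → Submodule Λ Λ) (O : Set ι) : Set Λ :=
  {x | ∃ i ∈ O, ∃ (f : P i →ₗ[Λ] Λ) (p : P i), f p = x}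

/-- A complete irredundant family of indecomposable projective left ideals of a ring which is
self-injective and left uniserial. -/
structure IsCoverFamily (P : ι → Submodule Λ Λ) : Prop where
  projective : ∀ i, Module.Projective Λ (P i)
  injective : ∀ i, Module.Injective Λ (P i)
  uniserial : ∀ i, IsUniserial Λ (P i)
  nontrivial : ∀ i, Nontrivial (P i)
  exists_hasTop : ∀ (M : Type u) [AddCommGroup M] [Module Λ M] [Module.Finite Λ M]
    [Nontrivial M], IsUniserial Λ M → ∃ i, HasTop P M i
  hasTop_unique : ∀ (M : Type u) [AddCommGroup M] [Module Λ M] [Nontrivial M] {i j : ι},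
    HasTop P M i → HasTop P M j → i = j
  one_mem : (1 : Λ) ∈ Submodule.span Λ (traceSet P Set.univ)

/-- The arrow `i → j` of the Ext-quiver: the radical of `P i` is nonzero with top that of `P j`. -/
def Arrow (P : ι → Submodule Λ Λ) (i j : ι) : Prop :=
  radSeries Λ (P i) 1 ≠ ⊥ ∧ HasTop P (radSeries Λ (P i) 1) j

lemma Arrow.hasTop_succ {i j : ι} {t : ℕ} (h : Arrow P i j)
    (hi : HasTop P (radSeries Λ M t) i) : HasTop P (radSeries Λ M (t + 1)) j := by
  obtain ⟨f, hf⟩ := hi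
  obtain ⟨g, hg⟩ := exists_radSeries_surjective hf 1
  obtain ⟨q, hq⟩ := exists_radSeries_add_surjective (Λ := Λ) (M := M) t 1
  exact (h.2.of_surjective hg).of_surjective hq

lemma mul_eq_zero_of_mem_traceSet {O O' : Set ι}
    (h : ∀ i ∈ O, ∀ j ∈ O', ∀ f : P i →ₗ[Λ] P j, f = 0) {x y : Λ}
    (hx : x ∈ Submodule.span Λ (traceSet P O)) (hy : y ∈ Submodule.span Λ (traceSet P O')) :
    x * y = 0 := by
  have key : ∀ x ∈ traceSet P O, x * y = 0 := by
    induction hy using Submodule.span_induction with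
    | mem y hy =>
      rintro x ⟨i, hi, f, p, rfl⟩
      obtain ⟨j, hj, g, q, rfl⟩ := hy
      have := LinearMap.congr_fun (h i hi j hj ((LinearMap.toSpanSingleton Λ (P j) q).comp f)) p
      have h0 : f p • q = 0 := this
      rw [← smul_eq_mul, ← map_smul, h0, map_zero]
    | zero => simp
    | add y z _ _ hy hz => intro x hx; rw [mul_add, hy x hx, hz x hx, add_zero]
    | smul r y _ hy =>
      rintro x ⟨i, hi, f, p, rfl⟩
      rw [smul_eq_mul, ← mul_assoc]
      exact hy _ ⟨i, hi, (LinearMap.toSpanSingleton Λ Λ r).comp f, p, rfl⟩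
  induction hx using Submodule.span_induction with
  | mem x hx => exact key x hx
  | zero => simp
  | add x z _ _ hx hz => rw [add_mul, hx, hz, add_zero]
  | smul r x _ hx => rw [smul_mul_assoc, hx, smul_zero]

lemma IsCoverFamily.eq_empty_of_span_traceSet_eq_zero (hP : IsCoverFamily P) {O : Set ι}
    (h : ∀ x ∈ Submodule.span Λ (traceSet P O), x = 0) : O = ∅ := by
  rw [Set.eq_empty_iff_forall_notMem]
  intro i hi
  have := hP.nontrivial i
  obtain ⟨p, hp⟩ := exists_ne (0 : P i)
  exact hp (Subtype.ext (h p (Submodule.subset_span ⟨i, hi, (P i).subtype, p, rfl⟩)))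

/-- Over a connected ring, a set of vertices orthogonal to its complement is trivial. -/
lemma IsCoverFamily.eq_empty_or_univ_of_hom_eq_zero (hP : IsCoverFamily P)
    (hconn : ∀ e : Λ, IsIdempotentElem e → e ∈ Set.center Λ → e = 0 ∨ e = 1) (O : Set ι)
    (h₁ : ∀ i ∈ O, ∀ j ∈ Oᶜ, ∀ f : P i →ₗ[Λ] P j, f = 0)
    (h₂ : ∀ i ∈ Oᶜ, ∀ j ∈ O, ∀ f : P i →ₗ[Λ] P j, f = 0) : O = ∅ ∨ O = Set.univ := by
  have hone : (1 : Λ) ∈ Submodule.span Λ (traceSet P O) ⊔ Submodule.span Λ (traceSet P Oᶜ) := by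
    rw [← Submodule.span_union]
    refine Submodule.span_mono ?_ hP.one_mem
    rintro x ⟨i, -, hx⟩
    exact (em (i ∈ O)).imp (fun hi => ⟨i, hi, hx⟩) fun hi => ⟨i, hi, hx⟩
  obtain ⟨a, ha, b, hb, hab⟩ := Submodule.mem_sup.1 hone
  have hxy {x y : Λ} := mul_eq_zero_of_mem_traceSet h₁ (x := x) (y := y)
  have hyx {x y : Λ} := mul_eq_zero_of_mem_traceSet h₂ (x := x) (y := y)
  have hidem : IsIdempotentElem a := by
    have : a * (a + b) = a := by rw [hab, mul_one]
    rwa [mul_add, hxy ha hb, add_zero] at this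
  have hcomm (c : Λ) : a * c = c * a := by
    have e₁ : a * c * (a + b) = a * c := by rw [hab, mul_one]
    have e₂ : (a + b) * (c * a) = c * a := by rw [hab, one_mul]
    rw [mul_add, mul_assoc a c b, hxy ha (show c * b ∈ _ from Submodule.smul_mem _ c hb),
      add_zero] at e₁
    rw [add_mul, hyx hb (show c * a ∈ _ from Submodule.smul_mem _ c ha), add_zero,
      ← mul_assoc] at e₂
    exact e₁.symm.trans e₂
  rcases hconn a hidem (Semigroup.mem_center_iff.2 fun c => (hcomm c).symm) with rfl | rfl
  · refine .inl (hP.eq_empty_of_span_traceSet_eq_zero fun x hx => ?_)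
    rw [zero_add] at hab
    rw [← mul_one x, ← hab, hxy hx hb]
  · refine .inr (Set.compl_empty_iff.1 (hP.eq_empty_of_span_traceSet_eq_zero fun x hx => ?_))
    rw [← mul_one x, hyx hx ha]

lemma IsCoverFamily.hasTop_radSeries_unique (hP : IsCoverFamily P) {i j j' : ι} {t : ℕ}
    (h : radSeries Λ (P i) t ≠ ⊥) (hj : HasTop P (radSeries Λ (P i) t) j)
    (hj' : HasTop P (radSeries Λ (P i) t) j') : j = j' :=
  have := Submodule.nontrivial_iff_ne_bot.2 h
  hP.hasTop_unique _ hj hj'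

lemma IsCoverFamily.hasTop_top (hP : IsCoverFamily P) (i : ι) :
    radSeries Λ (P i) 0 ≠ ⊥ ∧ HasTop P (radSeries Λ (P i) 0) i := by
  have := hP.nontrivial i
  exact ⟨top_ne_bot, Submodule.topEquiv.symm.toLinearMap, Submodule.topEquiv.symm.surjective⟩

lemma IsCoverFamily.exists_loewy (hP : IsCoverFamily P) {m : ℕ}
    (hm : ∀ i, radSeries Λ (P i) m = ⊥) (i : ι) :
    ∃ t, radSeries Λ (P i) t ≠ ⊥ ∧ radSeries Λ (P i) (t + 1) = ⊥ := by
  classical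
  have hex : ∃ t, radSeries Λ (P i) t = ⊥ := ⟨m, hm i⟩
  obtain ⟨t, ht⟩ : ∃ t, Nat.find hex = t + 1 :=
    Nat.exists_eq_succ_of_ne_zero fun h0 => (hP.hasTop_top i).1 (h0 ▸ Nat.find_spec hex)
  exact ⟨t, Nat.find_min hex (by omega), ht ▸ Nat.find_spec hex⟩

variable [IsArtinianRing Λ]

lemma IsCoverFamily.exists_hasTop_radSeries (hP : IsCoverFamily P) (i : ι) {t : ℕ}
    (h : radSeries Λ (P i) t ≠ ⊥) : ∃ j, HasTop P (radSeries Λ (P i) t) j :=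
  have := Submodule.nontrivial_iff_ne_bot.2 h
  hP.exists_hasTop _ ((hP.uniserial i).submodule _)

/-- The tops of the radical layers of `P j` lie in the connected component of `j`. -/
lemma IsCoverFamily.mem_iff_of_hasTop (hP : IsCoverFamily P) {O : Set ι}
    (hO : ∀ i j, Arrow P i j → (i ∈ O ↔ j ∈ O)) {i j : ι} {t : ℕ}
    (h : radSeries Λ (P j) t ≠ ⊥) (hi : HasTop P (radSeries Λ (P j) t) i) :
    i ∈ O ↔ j ∈ O := by
  induction t generalizing i with
  | zero => rw [hP.hasTop_radSeries_unique h hi (hP.hasTop_top j).2]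
  | succ t ih =>
    have ht : radSeries Λ (P j) t ≠ ⊥ := fun h0 =>
      h (le_bot_iff.1 (h0 ▸ radSeries_antitone t.le_succ))
    obtain ⟨l, hl⟩ := hP.exists_hasTop_radSeries j ht
    have hl1 : radSeries Λ (P l) 1 ≠ ⊥ := fun h0 => h <| by
      obtain ⟨f, hf⟩ := hl
      exact (radSeries_radSeries_eq_bot_iff t 1).1 (radSeries_eq_bot_of_surjective hf h0)
    obtain ⟨i', hi'⟩ := hP.exists_hasTop_radSeries l hl1
    have harr : Arrow P l i' := ⟨hl1, hi'⟩
    rw [hP.hasTop_radSeries_unique h hi (harr.hasTop_succ hl), ← hO l i' harr, ih ht hl]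

/-- The Ext-quiver of a connected ring is connected. -/
lemma IsCoverFamily.eq_empty_or_univ_of_arrow (hP : IsCoverFamily P)
    (hconn : ∀ e : Λ, IsIdempotentElem e → e ∈ Set.center Λ → e = 0 ∨ e = 1)
    {m : ℕ} (hm : ∀ i, radSeries Λ (P i) m = ⊥) {O : Set ι}
    (hO : ∀ i j, Arrow P i j → (i ∈ O ↔ j ∈ O)) : O = ∅ ∨ O = Set.univ := by
  have key (i j : ι) (f : P i →ₗ[Λ] P j) (hf : f ≠ 0) : i ∈ O ↔ j ∈ O := by
    obtain ⟨t, ht⟩ := (hP.uniserial j).exists_eq_radSeries (hm j) (LinearMap.range f)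
    have hne : LinearMap.range f ≠ ⊥ := fun h => hf (LinearMap.range_eq_bot.1 h)
    have htop : HasTop P (LinearMap.range f) i := ⟨f.rangeRestrict, f.surjective_rangeRestrict⟩
    rw [ht] at hne htop
    exact hP.mem_iff_of_hasTop hO hne htop
  refine hP.eq_empty_or_univ_of_hom_eq_zero hconn O (fun i hi j hj f => ?_) fun i hi j hj f => ?_
  · exact by_contra fun hf => hj ((key i j f hf).1 hi)
  · exact by_contra fun hf => hi ((key i j f hf).2 hj)

lemma IsCoverFamily.not_injective_of_arrow (hP : IsCoverFamily P) {i j : ι}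
    (f : P j →ₗ[Λ] radSeries Λ (P i) 1) (hf : Function.Surjective f) :
    ¬ Function.Injective f := fun hinj => by
  have := hP.nontrivial j
  let e := LinearEquiv.ofBijective f ⟨hinj, hf⟩
  obtain ⟨r, hr⟩ := (hP.injective j).out (radSeries Λ (P i) 1).subtype
    (Submodule.subtype_injective _) e.symm.toLinearMap
  have hr' (y : P j) : r (f y) = y := (hr (f y)).trans (e.symm_apply_apply y)
  have hsurj : Function.Surjective r := fun y => ⟨_, hr' y⟩
  have htop : (⊤ : Submodule Λ (P j)) ≤ radSeries Λ (P j) 1 := fun y _ => by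
    rw [← map_radSeries hsurj]
    exact ⟨f y, (f y).2, hr' y⟩
  exact top_ne_bot (Submodule.FG.eq_bot_of_le_jacobson_smul (IsNoetherian.noetherian _) htop)

lemma IsCoverFamily.radSeries_one_ne_bot [Nontrivial ι] (hP : IsCoverFamily P)
    (hconn : ∀ e : Λ, IsIdempotentElem e → e ∈ Set.center Λ → e = 0 ∨ e = 1)
    {m : ℕ} (hm : ∀ i, radSeries Λ (P i) m = ⊥) (i : ι) : radSeries Λ (P i) 1 ≠ ⊥ := by
  intro h
  have hO : ∀ l j, Arrow P l j → (l ∈ ({i} : Set ι) ↔ j ∈ ({i} : Set ι)) := fun l j hlj => by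
    have hl : l ≠ i := by
      rintro rfl
      exact hlj.1 h
    have hj : j ≠ i := by
      rintro rfl
      obtain ⟨f, hf⟩ := hlj.2
      have := Submodule.nontrivial_iff_ne_bot.2 hlj.1
      refine hP.not_injective_of_arrow f hf (LinearMap.ker_eq_bot.1 ?_)
      rw [(hP.uniserial j).ker_eq_radSeries hf (radSeries_eq_bot_of_surjective hf h), h]
      rintro r hr
      obtain rfl : r = 0 := by omega
      exact top_ne_bot
    simp [hl, hj]
  rcases hP.eq_empty_or_univ_of_arrow hconn hm hO with h0 | h0
  · exact Set.singleton_ne_empty i h0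
  · obtain ⟨j, hj⟩ := exists_ne i
    exact hj (Set.mem_singleton_iff.1 (h0 ▸ Set.mem_univ j))

lemma IsCoverFamily.eq_of_socle_hasTop (hP : IsCoverFamily P) {l l' j : ι} {t t' : ℕ}
    (ht : radSeries Λ (P l) t ≠ ⊥) (hts : radSeries Λ (P l) (t + 1) = ⊥)
    (hj : HasTop P (radSeries Λ (P l) t) j)
    (ht' : radSeries Λ (P l') t' ≠ ⊥) (hts' : radSeries Λ (P l') (t' + 1) = ⊥)
    (hj' : HasTop P (radSeries Λ (P l') t') j) : l = l' := by
  have := hP.nontrivial l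
  obtain ⟨f, hf⟩ := hj
  obtain ⟨f', hf'⟩ := hj'
  have hker : LinearMap.ker f = LinearMap.ker f' := by
    rw [(hP.uniserial j).ker_eq_radSeries hf ((radSeries_radSeries_eq_bot_iff t 1).2 hts),
      (hP.uniserial j).ker_eq_radSeries hf' ((radSeries_radSeries_eq_bot_iff t' 1).2 hts')] <;>
    · intro r hr
      obtain rfl : r = 0 := by omega
      rw [Ne, radSeries_radSeries_eq_bot_iff]
      assumption
  let e : radSeries Λ (P l) t ≃ₗ[Λ] radSeries Λ (P l') t' :=
    (f.quotKerEquivOfSurjective hf).symm ≪≫ₗ Submodule.quotEquivOfEq _ _ hker ≪≫ₗ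
      f'.quotKerEquivOfSurjective hf'
  obtain ⟨h, hh⟩ := (hP.injective l').out (radSeries Λ (P l) t).subtype
    (Submodule.subtype_injective _) ((radSeries Λ (P l') t').subtype.comp e.toLinearMap)
  have hzero (x : P l) (hx : x ∈ radSeries Λ (P l) t) (hx0 : h x = 0) : x = 0 := by
    have h1 : ((e ⟨x, hx⟩ : radSeries Λ (P l') t') : P l') = 0 := (hh ⟨x, hx⟩).symm.trans hx0
    have h2 : e ⟨x, hx⟩ = 0 := Subtype.ext h1
    exact congrArg Subtype.val ((LinearEquiv.map_eq_zero_iff e).1 h2)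
  have hinj : Function.Injective h := by
    rw [← LinearMap.ker_eq_bot, Submodule.eq_bot_iff]
    rcases hP.uniserial l (LinearMap.ker h) (radSeries Λ (P l) t) with hle | hle
    · exact fun x hx => hzero x (hle hx) hx
    · exact absurd ((Submodule.eq_bot_iff _).2 fun x hx => hzero x hx (hle hx)) ht
  obtain ⟨r, hr⟩ := (hP.injective l).out h hinj LinearMap.id
  exact hP.hasTop_unique (P l) ⟨LinearMap.id, Function.surjective_id⟩ ⟨r, fun x => ⟨_, hr x⟩⟩

/-- Every simple module is the socle of some `P l`. -/
lemma IsCoverFamily.exists_socle_hasTop [Finite ι] (hP : IsCoverFamily P) {m : ℕ}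
    (hm : ∀ i, radSeries Λ (P i) m = ⊥) (j : ι) :
    ∃ l t, radSeries Λ (P l) t ≠ ⊥ ∧ radSeries Λ (P l) (t + 1) = ⊥ ∧
      HasTop P (radSeries Λ (P l) t) j := by
  choose t ht hts using hP.exists_loewy hm
  choose ν hν using fun l => hP.exists_hasTop_radSeries l (ht l)
  have hinj : Function.Injective ν := fun l l' h =>
    hP.eq_of_socle_hasTop (ht l) (hts l) (hν l) (ht l') (hts l') (h ▸ hν l')
  obtain ⟨l, rfl⟩ := Finite.surjective_of_injective hinj j
  exact ⟨l, t l, ht l, hts l, hν l⟩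

/-- Loewy lengths do not decrease along arrows. -/
lemma IsCoverFamily.radSeries_ne_bot_of_arrow (hP : IsCoverFamily P) {m : ℕ}
    (hm : ∀ i, radSeries Λ (P i) m = ⊥) {i j : ι} (hij : Arrow P i j) {c : ℕ}
    (hc : radSeries Λ (P i) c ≠ ⊥) : radSeries Λ (P j) c ≠ ⊥ := by
  obtain ⟨t, ht, hts⟩ := hP.exists_loewy hm i
  have hct : c ≤ t := by
    by_contra hlt
    exact hc (le_bot_iff.1 (hts ▸ radSeries_antitone (by omega)))
  obtain ⟨f, hf⟩ := hij.2
  intro h0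
  refine hP.not_injective_of_arrow f hf (LinearMap.ker_eq_bot.1 ?_)
  rw [(hP.uniserial j).ker_eq_radSeries hf (s := t), ← le_bot_iff, ← h0]
  · exact radSeries_antitone hct
  · rwa [radSeries_radSeries_eq_bot_iff, add_comm]
  · rintro r rfl
    rwa [Ne, radSeries_radSeries_eq_bot_iff, add_comm]

/-- The Ext-quiver is an oriented cycle and all `P i` have the same Loewy length. -/
lemma IsCoverFamily.exists_cyclic_perm [Finite ι] [Nontrivial ι] (hP : IsCoverFamily P)
    (hconn : ∀ e : Λ, IsIdempotentElem e → e ∈ Set.center Λ → e = 0 ∨ e = 1)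
    {m : ℕ} (hm : ∀ i, radSeries Λ (P i) m = ⊥) {c : ℕ} (hc : ∃ i, radSeries Λ (P i) c ≠ ⊥) :
    (∀ i, radSeries Λ (P i) c ≠ ⊥) ∧ ∃ π : Equiv.Perm ι, (∀ i, π^[Nat.card ι] i = i) ∧
      ∀ i t, HasTop P (radSeries Λ (P i) t) (π^[t] i) := by
  choose π hπ using fun i => hP.exists_hasTop_radSeries i (hP.radSeries_one_ne_bot hconn hm i)
  have harr (i : ι) : Arrow P i (π i) := ⟨hP.radSeries_one_ne_bot hconn hm i, hπ i⟩
  have htop (i : ι) (t : ℕ) : HasTop P (radSeries Λ (P i) t) (π^[t] i) := by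
    induction t with
    | zero => exact (hP.hasTop_top i).2
    | succ t ih =>
      rw [Function.iterate_succ_apply']
      exact (harr _).hasTop_succ ih
  have hsurj : Function.Surjective π := fun j => by
    obtain ⟨l, t, ht, hts, hj⟩ := hP.exists_socle_hasTop hm j
    cases t with
    | zero => exact absurd hts (hP.radSeries_one_ne_bot hconn hm l)
    | succ t =>
      refine ⟨π^[t] l, hP.hasTop_radSeries_unique ht ?_ hj⟩
      rw [← Function.iterate_succ_apply' π]
      exact htop l (t + 1)
  have hbij : Function.Bijective π := ⟨Finite.injective_iff_surjective.2 hsurj, hsurj⟩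
  let σ : Equiv.Perm ι := Equiv.ofBijective π hbij
  have huniq {i j : ι} (h : Arrow P i j) : j = π i :=
    hP.hasTop_radSeries_unique h.1 h.2 (hπ i)
  constructor
  · let O : Set ι := {i | radSeries Λ (P i) c ≠ ⊥}
    have hmaps : Set.MapsTo π O O := fun i hi => hP.radSeries_ne_bot_of_arrow hm (harr i) hi
    have hO : ∀ i j, Arrow P i j → (i ∈ O ↔ j ∈ O) := fun i j hij => by
      rw [huniq hij]
      refine ⟨fun hi => hmaps hi, fun hi => ?_⟩
      have him : π '' O = O := Set.eq_of_subset_of_ncard_le hmaps.image_subset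
        (Set.ncard_image_of_injective O hbij.1).ge (Set.toFinite O)
      obtain ⟨i', hi', h⟩ := him.ge hi
      rwa [← hbij.1 h]
    obtain ⟨i, hi⟩ := hc
    rcases hP.eq_empty_or_univ_of_arrow hconn hm hO with h | h
    · exact absurd (show i ∈ O from hi) (h ▸ Set.notMem_empty i)
    · exact fun i => show i ∈ O from h ▸ Set.mem_univ i
  · refine ⟨σ, fun i => ?_, htop⟩
    have hcycle (a b : ι) : σ.SameCycle a b := by
      have hO : ∀ i j, Arrow P i j → (i ∈ {b | σ.SameCycle a b} ↔ j ∈ {b | σ.SameCycle a b}) :=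
        fun i j hij => by
          rw [huniq hij]
          exact (Equiv.Perm.sameCycle_apply_right (f := σ)).symm
      rcases hP.eq_empty_or_univ_of_arrow hconn hm hO with h | h
      · exact absurd (show a ∈ {b | σ.SameCycle a b} from Equiv.Perm.SameCycle.refl σ a)
          (h ▸ Set.notMem_empty a)
      · exact show b ∈ {b | σ.SameCycle a b} from h ▸ Set.mem_univ b
    classical
    have := Fintype.ofFinite ι
    have hon : σ.IsCycleOn ((Finset.univ : Finset ι) : Set ι) :=
      ⟨by simp, fun a _ b _ => hcycle a b⟩
    have := hon.pow_card_apply (Finset.mem_univ i)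
    rwa [Finset.card_univ, ← Nat.card_eq_fintype_card, Equiv.Perm.coe_pow] at this

/-- If the number of simples divides the Loewy length, the second syzygy of a non-projective
uniserial module `X` is isomorphic to `X`. -/
lemma IsCoverFamily.exists_periodic_resolution [Finite ι] [Nontrivial ι] (hP : IsCoverFamily P)
    (hconn : ∀ e : Λ, IsIdempotentElem e → e ∈ Set.center Λ → e = 0 ∨ e = 1)
    {c : ℕ} (hm : ∀ i, radSeries Λ (P i) (c + 1) = ⊥) (hc : ∃ i, radSeries Λ (P i) c ≠ ⊥)
    (hdvd : Nat.card ι ∣ c + 1) [Module.Finite Λ M] [Nontrivial M] (hM : IsUniserial Λ M)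
    (hproj : ¬ Module.Projective Λ M) :
    ∃ (a b : ι) (f : P a →ₗ[Λ] M) (g : P b →ₗ[Λ] LinearMap.ker f),
      Function.Surjective f ∧ Function.Surjective g ∧ Nonempty (LinearMap.ker g ≃ₗ[Λ] M) := by
  obtain ⟨hne, π, hπ, htop⟩ := hP.exists_cyclic_perm hconn hm hc
  obtain ⟨a, f, hf⟩ := hP.exists_hasTop M hM
  have hbot {t : ℕ} (i : ι) (ht : t ≤ c) : radSeries Λ (P i) t ≠ ⊥ := fun h0 =>
    hne i (le_bot_iff.1 (h0 ▸ radSeries_antitone ht))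
  obtain ⟨t, hker, ht, ht', htc⟩ : ∃ t, LinearMap.ker f = radSeries Λ (P a) t ∧
      radSeries Λ M t = ⊥ ∧ (∀ r, r + 1 = t → radSeries Λ M r ≠ ⊥) ∧ t ≤ c := by
    classical
    have hex : ∃ t, radSeries Λ M t = ⊥ := ⟨c + 1, radSeries_eq_bot_of_surjective hf (hm a)⟩
    have hmin (r : ℕ) (hr : r + 1 = Nat.find hex) : radSeries Λ M r ≠ ⊥ :=
      Nat.find_min hex (by omega)
    have hker := (hP.uniserial a).ker_eq_radSeries hf (Nat.find_spec hex) hmin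
    refine ⟨Nat.find hex, hker, Nat.find_spec hex, hmin, ?_⟩
    by_contra hlt
    have hinj : LinearMap.ker f = ⊥ := by
      rw [hker, ← le_bot_iff, ← hm a]
      exact radSeries_antitone (by omega)
    have := hP.projective a
    exact hproj (Module.Projective.of_equiv
      (LinearEquiv.ofBijective f ⟨LinearMap.ker_eq_bot.1 hinj, hf⟩))
  have ht0 : t ≠ 0 := by
    rintro rfl
    exact top_ne_bot ht
  obtain ⟨g, hg⟩ : HasTop P (LinearMap.ker f) (π^[t] a) := hker ▸ htop a t
  have hkg : LinearMap.ker g = radSeries Λ (P (π^[t] a)) (c + 1 - t) := by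
    refine (hP.uniserial _).ker_eq_radSeries hg ?_ ?_
    · rw [hker, radSeries_radSeries_eq_bot_iff, Nat.add_sub_cancel' (by omega), hm]
    · intro r hr
      rw [hker, Ne, radSeries_radSeries_eq_bot_iff]
      exact hbot a (by omega)
  obtain ⟨h, hh⟩ : HasTop P (LinearMap.ker g) a := by
    have := htop (π^[t] a) (c + 1 - t)
    rw [← hkg, ← Function.iterate_add_apply, Nat.sub_add_cancel (by omega)] at this
    obtain ⟨q, hq⟩ := hdvd
    rwa [hq, Function.iterate_mul, Function.iterate_fixed (hπ a)] at this
  have hkh : LinearMap.ker h = LinearMap.ker f := by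
    refine Eq.trans ?_ hker.symm
    refine (hP.uniserial a).ker_eq_radSeries hh ?_ ?_
    · rw [hkg, radSeries_radSeries_eq_bot_iff, Nat.sub_add_cancel (by omega), hm]
    · intro r hr
      rw [hkg, Ne, radSeries_radSeries_eq_bot_iff]
      exact hbot _ (by omega)
  exact ⟨a, _, f, g, hf, hg, ⟨(h.quotKerEquivOfSurjective hh).symm ≪≫ₗ
    Submodule.quotEquivOfEq _ _ hkh ≪≫ₗ f.quotKerEquivOfSurjective hf⟩⟩

end CoverFamily


section Nakayama

lemma IsCoverFamily.exists_radSeries_ne_bot {Λ : Type u} [Ring Λ] {ι : Type}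
    {P : ι → Submodule Λ Λ} (hP : IsCoverFamily P) {c : ℕ} (hc : radSeries Λ Λ c ≠ ⊥) :
    ∃ i, radSeries Λ (P i) c ≠ ⊥ := by
  by_contra! h
  have key (y : Λ) (hy : y ∈ Submodule.span Λ (traceSet P Set.univ)) :
      ∀ r ∈ radSeries Λ Λ c, r * y = 0 := by
    induction hy using Submodule.span_induction with
    | mem y hy =>
      rintro r hr
      obtain ⟨i, -, f, p, rfl⟩ := hy
      have hrp : r • p ∈ radSeries Λ (P i) c :=
        map_radSeries_le (LinearMap.toSpanSingleton Λ (P i) p) c (Submodule.mem_map_of_mem hr)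
      rw [h, Submodule.mem_bot] at hrp
      rw [← smul_eq_mul, ← map_smul, hrp, map_zero]
    | zero => simp
    | add y z _ _ hy hz => intro r hr; rw [mul_add, hy r hr, hz r hr, add_zero]
    | smul s y _ hy =>
      intro r hr
      rw [smul_eq_mul, ← mul_assoc]
      exact hy _ (map_radSeries_le (LinearMap.toSpanSingleton Λ Λ s) c
        (Submodule.mem_map_of_mem hr))
  exact hc ((Submodule.eq_bot_iff _).2 fun r hr => by rw [← mul_one r, key 1 hP.one_mem r hr])

lemma radPow_eq_radSeries (Λ : Type u) [Ring Λ] (t : ℕ) : radPow Λ t = radSeries Λ Λ t := by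
  induction t with
  | zero => rfl
  | succ t ih =>
    rw [radSeries_succ, ← ih, ← Ideal.jacobson_bot]
    apply le_antisymm
    · refine Submodule.span_le.2 ?_
      rintro _ ⟨a, ha, b, hb, rfl⟩
      exact Submodule.smul_mem_smul ha hb
    · exact Submodule.smul_le.2 fun a ha b hb => Submodule.subset_span ⟨a, ha, b, hb, rfl⟩

variable {k Λ : Type u} [Field k] [Ring Λ] [Algebra k Λ] {n m : ℕ}
variable {M : Type u} [AddCommGroup M] [Module Λ M]

lemma IsSelfInjNakayama.isUniserial (hΛ : IsSelfInjNakayama k Λ n m) [Module.Finite Λ M]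
    [Nontrivial M] (h : ∀ A B : Submodule Λ M, IsCompl A B → A = ⊥ ∨ B = ⊥) :
    IsUniserial Λ M := by
  refine hΛ.uniserial (ModuleCat.of Λ M) ‹_› ⟨?_, ?_⟩
  · rw [ModuleCat.isZero_iff_subsingleton]
    exact not_subsingleton M
  · rintro A B ⟨e⟩
    let e' : M ≃ₗ[Λ] A × B := (e ≪≫ ModuleCat.biprodIsoProd A B).toLinearEquiv
    have hc := (Submodule.orderIsoMapComap e'.symm).isCompl
      (LinearMap.isCompl_range_inl_inr (R := Λ) (M := A) (M₂ := B))
    simp only [ModuleCat.isZero_iff_subsingleton]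
    refine (h _ _ hc).imp (fun h0 => ?_) fun h0 => ?_
    all_goals
      rw [map_eq_bot_iff, LinearMap.range_eq_bot] at h0
      refine subsingleton_of_forall_eq 0 fun x => ?_
      simpa using LinearMap.congr_fun h0 x

lemma IsSelfInjNakayama.isArtinianRing (hΛ : IsSelfInjNakayama k Λ n m) : IsArtinianRing Λ :=
  have := hΛ.findim
  IsArtinianRing.of_finite k Λ

/-- Uniserial modules have uniserial projective covers, realized as left ideals. -/
lemma IsSelfInjNakayama.exists_isCompl_surjective (hΛ : IsSelfInjNakayama k Λ n m)
    [Module.Finite Λ M] [Nontrivial M] (hM : IsUniserial Λ M) :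
    ∃ P Q : Submodule Λ Λ, IsCompl P Q ∧ IsUniserial Λ P ∧
      ∃ f : P →ₗ[Λ] M, Function.Surjective f := by
  have := hΛ.isArtinianRing
  obtain ⟨K, hK⟩ := IsCoatomic.exists_coatom (Submodule Λ M)
  obtain ⟨x, hx⟩ : ∃ x, x ∉ K := by
    by_contra! h
    exact hK.1 ((Submodule.eq_top_iff').2 h)
  have hsurj := hM.surjective_of_not_range_le hK (f := LinearMap.toSpanSingleton Λ M x)
    fun hle => hx (hle ⟨1, one_smul Λ x⟩)
  obtain ⟨P, ⟨⟨Q, hPQ⟩, f, hf⟩, hmin⟩ := exists_minimal_of_wellFoundedLT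
    (fun P : Submodule Λ Λ => (∃ Q, IsCompl P Q) ∧ ∃ f : P →ₗ[Λ] M, Function.Surjective f)
    ⟨⊤, ⟨⊥, isCompl_top_bot⟩,
      (LinearMap.toSpanSingleton Λ M x).comp Submodule.topEquiv.toLinearMap,
      hsurj.comp Submodule.topEquiv.surjective⟩
  refine ⟨P, Q, hPQ, ?_, f, hf⟩
  have : Nontrivial P := hf.nontrivial
  have key (A B : Submodule Λ P) (hAB : IsCompl A B) (hA : A.map f = ⊤) : B = ⊥ := by
    have hdisj : Disjoint (A.map P.subtype) (B.map P.subtype) :=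
      Submodule.disjoint_map P.subtype_injective hAB.disjoint
    have hsup : A.map P.subtype ⊔ B.map P.subtype = P := by
      rw [← Submodule.map_sup, hAB.sup_eq_top, Submodule.map_top, Submodule.range_subtype]
    have hcompl := hdisj.isCompl_sup_right_of_isCompl_sup_left (hsup.symm ▸ hPQ)
    have hle : A.map P.subtype ≤ P := Submodule.map_subtype_le P A
    have hPA := hmin (y := A.map P.subtype) ⟨⟨_, hcompl⟩, f.comp (Submodule.inclusion hle), by
      intro y
      obtain ⟨a, ha, rfl⟩ := hA.ge (Submodule.mem_top (x := y))
      exact ⟨⟨a, Submodule.mem_map_of_mem ha⟩, rfl⟩⟩ hle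
    have hB := hdisj.eq_bot_of_ge ((Submodule.map_subtype_le P B).trans hPA)
    rwa [← LinearMap.le_ker_iff_map, Submodule.ker_subtype, le_bot_iff] at hB
  refine hΛ.isUniserial fun A B hAB => ?_
  have hsup : A.map f ⊔ B.map f = ⊤ := by
    rw [← Submodule.map_sup, hAB.sup_eq_top, Submodule.map_top, LinearMap.range_eq_top.2 hf]
  exact (hM.eq_top_of_sup_eq_top hsup).symm.imp (key B A hAB.symm) (key A B hAB)

lemma IsSelfInjNakayama.exists_isCoverFamily (hΛ : IsSelfInjNakayama k Λ n m) :
    ∃ P : Fin n → Submodule Λ Λ, IsCoverFamily P := by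
  have := hΛ.isArtinianRing
  obtain ⟨S, hS, hSinj, hSsurj⟩ := hΛ.simples
  have hSnontrivial (i : Fin n) : Nontrivial (S i) := IsSimpleModule.nontrivial Λ (S i)
  have hSuni (i : Fin n) : IsUniserial Λ (S i) := fun A B =>
    (eq_bot_or_eq_top A).imp (fun h => h.le.trans bot_le) fun h => le_top.trans h.ge
  choose P Q hPQ huni π hπ using fun i => hΛ.exists_isCompl_surjective (hSuni i)
  have hproj (i : Fin n) : Module.Projective Λ (P i) :=
    .of_split (P i).subtype (Submodule.projectionOnto _ _ (hPQ i)) <| by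
      ext x
      simp
  have hlift (M : Type u) [AddCommGroup M] [Module Λ M] (K : Submodule Λ M) (hK : IsCoatom K) :
      ∃ i, ∃ g : P i →ₗ[Λ] M, ¬ LinearMap.range g ≤ K := by
    have hsimple := isSimpleModule_iff_isCoatom.2 hK
    obtain ⟨i, ⟨e⟩⟩ := hSsurj (ModuleCat.of Λ (M ⧸ K)) hsimple
    obtain ⟨g, hg⟩ := Module.projective_lifting_property K.mkQ
      (e.toLinearEquiv.symm.toLinearMap.comp (π i)) (Submodule.mkQ_surjective K)
    refine ⟨i, g, fun hle => ?_⟩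
    have hzero : K.mkQ.comp g = 0 := LinearMap.ext fun x =>
      (Submodule.Quotient.mk_eq_zero K).2 (hle (LinearMap.mem_range_self g x))
    obtain ⟨y, hy⟩ := exists_ne (0 : S i)
    obtain ⟨x, rfl⟩ := hπ i y
    refine hy ((LinearEquiv.map_eq_zero_iff e.toLinearEquiv.symm).1 ?_)
    exact LinearMap.congr_fun (hg.symm.trans hzero) x
  refine ⟨P, hproj, fun i => ⟨?_⟩, huni, fun i => (hπ i).nontrivial, ?_, ?_, ?_⟩
  · intro X Y _ _ _ _ f hf g
    have := (Module.injective_iff_injective_object Λ Λ).2 hΛ.selfinj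
    obtain ⟨h, hh⟩ := this.out f hf ((P i).subtype.comp g)
    refine ⟨(Submodule.projectionOnto _ _ (hPQ i)).comp h, fun x => ?_⟩
    simp [hh]
  · intro M _ _ _ _ hM
    obtain ⟨K, hK⟩ := IsCoatomic.exists_coatom (Submodule Λ M)
    obtain ⟨i, g, hg⟩ := hlift M K hK
    exact ⟨i, g, hM.surjective_of_not_range_le hK hg⟩
  · rintro M _ _ _ i j ⟨f, hf⟩ ⟨g, hg⟩
    obtain ⟨h, hh⟩ := Module.projective_lifting_property g f hg
    have hsup : LinearMap.range h ⊔ LinearMap.ker g = ⊤ := by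
      rw [← Submodule.comap_map_eq, ← LinearMap.range_comp, hh, LinearMap.range_eq_top.2 hf,
        Submodule.comap_top]
    have hgtop : LinearMap.ker g ≠ ⊤ := fun h0 => by
      obtain ⟨y, hy⟩ := exists_ne (0 : M)
      obtain ⟨x, rfl⟩ := hg y
      exact hy (h0.ge (Submodule.mem_top (x := x)))
    have hhsurj : Function.Surjective h := LinearMap.range_eq_top.1
      (((huni j).eq_top_of_sup_eq_top hsup).resolve_right hgtop)
    have hcoatom {l : Fin n} {q : P i →ₗ[Λ] S l} (hq : Function.Surjective q) :
        IsCoatom (LinearMap.ker q) :=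
      isSimpleModule_iff_isCoatom.1 (.congr (q.quotKerEquivOfSurjective hq))
    have hj := (hπ j).comp hhsurj
    rw [← LinearMap.coe_comp] at hj
    exact hSinj i j ⟨((((π i).quotKerEquivOfSurjective (hπ i)).symm ≪≫ₗ
      Submodule.quotEquivOfEq _ _ ((huni i).eq_of_isCoatom (hcoatom (hπ i)) (hcoatom hj))) ≪≫ₗ
      LinearMap.quotKerEquivOfSurjective _ hj).toModuleIso⟩
  · by_contra hone
    obtain ⟨K, hK, hle⟩ := (eq_top_or_exists_le_coatom
      (Submodule.span Λ (traceSet P Set.univ))).resolve_left fun h => hone (h ▸ Submodule.mem_top)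
    obtain ⟨i, g, hg⟩ := hlift Λ K hK
    refine hg (le_trans ?_ hle)
    rintro _ ⟨p, rfl⟩
    exact Submodule.subset_span ⟨i, Set.mem_univ i, g, p, rfl⟩

end Nakayama

section Ext

open Abelian

variable {C : Type*} [Category* C] [Abelian C] [HasExt C] {S : ShortComplex C}

lemma subsingleton_ext_X₁ (hS : S.ShortExact) [Projective S.X₂] (Y : C) (j : ℕ)
    [Subsingleton (Ext S.X₃ Y (j + 2))] : Subsingleton (Ext S.X₁ Y (j + 1)) := by
  refine subsingleton_of_forall_eq 0 fun x => ?_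
  obtain ⟨y, rfl⟩ := Ext.contravariant_sequence_exact₁ hS Y x (n₁ := j + 2) (by omega)
    (Subsingleton.elim _ _)
  rw [Ext.eq_zero_of_projective y, Ext.comp_zero]

lemma exists_factor_of_subsingleton_ext (hS : S.ShortExact) {Y : C}
    [Subsingleton (Ext S.X₃ Y 1)] (φ : S.X₁ ⟶ Y) : ∃ ψ : S.X₂ ⟶ Y, S.f ≫ ψ = φ := by
  obtain ⟨y, hy⟩ := Ext.contravariant_sequence_exact₁ hS Y (Ext.mk₀ φ) (n₁ := 1) rfl
    (Subsingleton.elim _ _)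
  obtain ⟨ψ, rfl⟩ := (Ext.mk₀_bijective _ _).2 y
  exact ⟨ψ, by rwa [Ext.mk₀_comp_mk₀, (Ext.mk₀_bijective _ _).1.eq_iff] at hy⟩

lemma subsingleton_ext_of_iso {A B : C} (e : A ≅ B) (Y : C) (j : ℕ)
    [Subsingleton (Ext A Y j)] : Subsingleton (Ext B Y j) := by
  refine subsingleton_of_forall_eq 0 fun x => ?_
  have h : (Ext.mk₀ e.hom).comp x (zero_add j) = 0 := Subsingleton.elim _ _
  rw [← Ext.mk₀_id_comp x, ← e.inv_hom_id, ← Ext.mk₀_comp_mk₀_assoc, h, Ext.comp_zero]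

/-- A non-projective object isomorphic to its second syzygy has nonzero even self-extensions. -/
lemma not_subsingleton_ext_of_periodic {S T : ShortComplex C} (hS : S.ShortExact)
    (hT : T.ShortExact) [Projective S.X₂] [Projective T.X₂] (e : T.X₃ = S.X₁)
    (e' : T.X₁ ≅ S.X₃) (hproj : ¬ Projective S.X₃) (j : ℕ) :
    ¬ Subsingleton (Ext S.X₃ S.X₃ (2 * j + 2)) := by
  induction j with
  | zero =>
    intro h
    have : Subsingleton (Ext T.X₃ S.X₃ 1) := e ▸ subsingleton_ext_X₁ hS S.X₃ 0
    obtain ⟨ψ, hψ⟩ := exists_factor_of_subsingleton_ext hT e'.hom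
    exact hproj (Retract.mk (e'.inv ≫ T.f) ψ (by simp [hψ])).projective
  | succ j ih =>
    intro h
    have : Subsingleton (Ext T.X₃ S.X₃ (2 * j + 1 + 2)) :=
      e ▸ subsingleton_ext_X₁ hS S.X₃ (2 * j + 2)
    have := subsingleton_ext_X₁ hT S.X₃ (2 * j + 1)
    exact ih (subsingleton_ext_of_iso e' S.X₃ _)

end Ext

/-- for `Λ = A_{n,m}` with `n > 1` and `n ∣ m`, every indecomposable
non-projective module `X` satisfies `Ext^{2i}(X,X) ≠ 0` for all `i ≥ 1`,
hence `rd(X) ≤ 1`. -/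
theorem statement14 (k : Type u) [Field k] (Λ : Type u) [Ring Λ] [Algebra k Λ]
    (n m : ℕ) (hn : 1 < n) (hnm : n ≤ m) (hdvd : n ∣ m)
    (hΛ : IsSelfInjNakayama k Λ n m)
    [HasExt.{u} (ModuleCat.{u} Λ)]
    (X : ModuleCat.{u} Λ) (hXfin : Module.Finite Λ X) (hXind : Indec Λ X)
    (hXnp : ¬ Projective X) :
    (∀ i : ℕ, 1 ≤ i → ¬ Subsingleton (Abelian.Ext X X (2 * i))) ∧
    rigDeg Λ X ≤ 1 := by
  obtain ⟨P, hP⟩ := hΛ.exists_isCoverFamily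
  have := hΛ.isArtinianRing
  have : Nontrivial X := by
    rw [← not_subsingleton_iff_nontrivial, ← ModuleCat.isZero_iff_subsingleton]
    exact hXind.1
  have : Nontrivial (Fin n) := Fin.nontrivial_iff_two_le.2 hn
  obtain ⟨c, rfl⟩ : ∃ c, m = c + 1 := Nat.exists_eq_succ_of_ne_zero (by omega)
  have htop (i : Fin n) : radSeries Λ (P i) (c + 1) = ⊥ :=
    radSeries_eq_bot_of_injective (P i).subtype_injective
      ((radPow_eq_radSeries Λ _).symm.trans hΛ.loewy_top)
  have hbot : radSeries Λ Λ c ≠ ⊥ := radPow_eq_radSeries Λ c ▸ hΛ.loewy_bot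
  obtain ⟨a, b, f, g, hf, hg, ⟨e⟩⟩ := hP.exists_periodic_resolution hΛ.connected htop
    (hP.exists_radSeries_ne_bot hbot) (by rwa [Nat.card_fin]) (hΛ.uniserial X hXfin hXind)
    fun h => hXnp ((IsProjective.iff_projective X).1 h)
  have := (IsProjective.iff_projective (P a)).1 (hP.projective a)
  have := (IsProjective.iff_projective (P b)).1 (hP.projective b)
  have key (i : ℕ) (hi : 1 ≤ i) : ¬ Subsingleton (Abelian.Ext X X (2 * i)) := by
    obtain ⟨j, rfl⟩ : ∃ j, i = j + 1 := Nat.exists_eq_succ_of_ne_zero (by omega)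
    exact not_subsingleton_ext_of_periodic (LinearMap.shortExact_shortComplexKer hf)
      (LinearMap.shortExact_shortComplexKer hg) rfl e.toModuleIso hXnp j
  refine ⟨key, sSup_le ?_⟩
  rintro _ ⟨r, rfl, -, hr⟩
  by_contra! hlt
  exact key 1 le_rfl (hr 2 (by omega) (by exact_mod_cast hlt))

end Rigidity
end

section
/- Let Λ = A_{n,m} with m > n, δ = max{n, (k₀−1)n}, and let t be an integer with 0 ≤ m − δ − t ≤ t ≤ m/2. Let L be the direct sum of the indecomposable modules π(0,z) for 1 ≤ z ≤ t and T the direct sum of the π(z, δ+t−z) for δ+t−m+1 ≤ z ≤ 0. Then the generator-cogenerator N = Λ ⊕ L ⊕ T satisfies rd(N) = rd(π(0,t)), i.e. the rigidity degree of N equals that of the single indecomposable module of length t. -/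
open CategoryTheory CategoryTheory.Limits Opposite

universe u

namespace Rigidity

variable (Λ : Type u) [Ring Λ]

/-- A combinatorial model of the self-injective Nakayama algebra `A_{n,m}`:
the family `uni x t` realizes the indecomposable `π(x,t)` (uniserial of length `t`,
with the covering `ℤA_{m-1} → ℤA_{m-1}/⟨τ^n⟩` built into the periodicity axiom, and
the canonical short exact sequences `0 → π(x+t, t') → π(x, t+t') → π(x,t) → 0`). -/
structure NakayamaModel (k : Type u) (Λ : Type u) [Field k] [Ring Λ] [Algebra k Λ]
    (n m : ℕ) where
  base : IsSelfInjNakayama k Λ n m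
  uni : ℤ → ℕ → ModuleCat.{u} Λ
  uni_zero : ∀ x : ℤ, IsZero (uni x 0)
  uni_indec : ∀ (x : ℤ) (t : ℕ), 1 ≤ t → t ≤ m → Indec Λ (uni x t) ∧ Module.Finite Λ (uni x t)
  uni_len : ∀ (x : ℤ) (t : ℕ), t ≤ m → HasCompLength Λ (uni x t) t
  uni_per : ∀ (x : ℤ) (t : ℕ), Nonempty (uni (x + n) t ≅ uni x t)
  uni_proj : ∀ x : ℤ, Projective (uni x m)
  uni_all : ∀ X : ModuleCat.{u} Λ, Module.Finite Λ X → Indec Λ X →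
    ∃ (x : ℤ) (t : ℕ), 1 ≤ t ∧ t ≤ m ∧ Nonempty (X ≅ uni x t)
  uni_ses : ∀ (x : ℤ) (t t' : ℕ), 1 ≤ t → 1 ≤ t' → t + t' ≤ m →
    ∃ (f : uni (x + t) t' ⟶ uni x (t + t')) (g : uni x (t + t') ⟶ uni x t),
      Mono f ∧ Epi g ∧ ∃ wz : f ≫ g = 0, (ShortComplex.mk f g wz).Exact


section Length

variable {R : Type*} [Ring R] {M N P : Type*} [AddCommGroup M] [Module R M]
  [AddCommGroup N] [Module R N] [AddCommGroup P] [Module R P]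

lemma le_of_length_le_of_chain (hc : ∀ A B : Submodule R M, A ≤ B ∨ B ≤ A)
    (hM : Module.length R M ≠ ⊤) {A B : Submodule R M}
    (h : Module.length R A ≤ Module.length R B) : A ≤ B := by
  rcases hc A B with h1 | h1
  · exact h1
  · rcases eq_or_lt_of_le h1 with h2 | h2
    · exact h2.ge
    · rw [Module.length_submodule, Module.length_submodule] at h
      have hB : Order.height B < ⊤ := by
        rw [← Module.length_submodule]
        exact lt_of_le_of_lt (Module.length_le_of_injective B.subtype B.injective_subtype)
          (lt_top_iff_ne_top.mpr hM)
      exact absurd (Order.height_strictMono h2 hB) (not_lt.mpr h)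

lemma length_ker_add_length_range (f : M →ₗ[R] N) :
    Module.length R M = Module.length R (LinearMap.ker f) + Module.length R (LinearMap.range f) :=
  Module.length_eq_add_of_exact (LinearMap.ker f).subtype f.rangeRestrict
    (Submodule.injective_subtype _) f.surjective_rangeRestrict
    (by
      rw [LinearMap.exact_iff]
      simp)

lemma exists_length_eq_of_le {a : ℕ} (hM : Module.length R M = a)
    (h : Module.length R N ≤ Module.length R M) :
    ∃ b : ℕ, Module.length R N = b ∧ b ≤ a := by
  rw [hM] at h
  have h1 : Module.length R N ≠ ⊤ := ne_top_of_le_ne_top (ENat.natCast_ne_top a) h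
  obtain ⟨b, hb⟩ := ENat.ne_top_iff_exists.mp h1
  refine ⟨b, hb.symm, ?_⟩
  rw [← hb] at h
  exact_mod_cast h

/-- Two quotients of equal length of a module with totally ordered submodules are isomorphic. -/
lemma nonempty_linearEquiv_of_surjective (hc : ∀ A B : Submodule R M, A ≤ B ∨ B ≤ A)
    {a : ℕ} (hM : Module.length R M = a) (p : M →ₗ[R] N) (q : M →ₗ[R] P)
    (hp : Function.Surjective p) (hq : Function.Surjective q)
    (h : Module.length R N = Module.length R P) : Nonempty (N ≃ₗ[R] P) := by
  have hM' : Module.length R M ≠ ⊤ := hM ▸ ENat.natCast_ne_top a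
  have h1 := length_ker_add_length_range p
  have h2 := length_ker_add_length_range q
  rw [LinearMap.range_eq_top.mpr hp, Module.length_top] at h1
  rw [LinearMap.range_eq_top.mpr hq, Module.length_top] at h2
  have hN : Module.length R N ≠ ⊤ := ne_top_of_le_ne_top hM' (Module.length_le_of_surjective p hp)
  have h3 : Module.length R (LinearMap.ker p) = Module.length R (LinearMap.ker q) := by
    rw [h1, h] at h2
    rw [h] at hN
    exact (WithTop.add_right_inj hN).mp h2
  have h4 : LinearMap.ker p = LinearMap.ker q :=
    le_antisymm (le_of_length_le_of_chain hc hM' h3.le) (le_of_length_le_of_chain hc hM' h3.ge)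
  exact ⟨(p.quotKerEquivOfSurjective hp).symm.trans
    ((Submodule.quotEquivOfEq _ _ h4).trans (q.quotKerEquivOfSurjective hq))⟩

/-- The image of an extension `F` of a nonzero map `F ∘ ι` along an embedding `ι : M → N` of
colength `a` is exactly `a` longer. -/
lemma length_range_eq_of_comp_ne_zero (hc : ∀ A B : Submodule R N, A ≤ B ∨ B ≤ A)
    {a b : ℕ} (hM : Module.length R M = b) (hN : Module.length R N = (a + b : ℕ))
    (ι : M →ₗ[R] N) (hι : Function.Injective ι) (F : N →ₗ[R] P) (h0 : F ∘ₗ ι ≠ 0) :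
    Module.length R (LinearMap.range F) =
      a + Module.length R (LinearMap.range (F ∘ₗ ι)) := by
  have h1 : LinearMap.ker F ≤ LinearMap.range ι := by
    rcases hc (LinearMap.ker F) (LinearMap.range ι) with h | h
    · exact h
    · exact absurd (LinearMap.range_le_ker_iff.mp h) h0
  have h2 : (LinearMap.ker (F ∘ₗ ι)).map ι = LinearMap.ker F := by
    rw [LinearMap.ker_comp, Submodule.map_comap_eq, inf_eq_right.mpr h1]
  have h3 : Module.length R (LinearMap.ker (F ∘ₗ ι)) = Module.length R (LinearMap.ker F) := by
    rw [← h2]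
    exact ((LinearMap.ker (F ∘ₗ ι)).equivMapOfInjective ι hι).length_eq
  have h4 := length_ker_add_length_range F
  have h5 := length_ker_add_length_range (F ∘ₗ ι)
  rw [h3] at h5
  obtain ⟨c, hc, -⟩ := exists_length_eq_of_le hN
    (Module.length_le_of_injective _ (LinearMap.ker F).injective_subtype)
  obtain ⟨d, hd, -⟩ := exists_length_eq_of_le hN
    (Module.length_le_of_surjective _ F.surjective_rangeRestrict)
  obtain ⟨e, he, -⟩ := exists_length_eq_of_le hM
    (Module.length_le_of_surjective _ (F ∘ₗ ι).surjective_rangeRestrict)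
  rw [hN, hc, hd] at h4
  rw [hM, hc, he] at h5
  rw [hd, he]
  norm_cast at h4 h5 ⊢
  omega

end Length

lemma HasCompLength.length_eq {Λ : Type u} [Ring Λ] {X : ModuleCat.{u} Λ} {t : ℕ}
    (h : HasCompLength Λ X t) : Module.length Λ X = t := by
  obtain ⟨⟨c, hc, -, -⟩, h2⟩ := h
  apply WithBot.coe_injective
  rw [Module.coe_length]
  apply le_antisymm
  · rw [Order.krullDim, iSup_le_iff]
    intro p
    have hp : p.length ≤ t := by
      rcases Nat.eq_zero_or_pos p.length with h0 | h0
      · omega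
      refine h2 p.length ⟨fun i => if i = 0 then ⊥ else if i = Fin.last _ then ⊤ else p i, ?_,
        by simp, ?_⟩
      · intro i j hij
        have hlt := p.strictMono hij
        have hj : j ≠ 0 := (Fin.pos_of_ne_zero (by rintro rfl; exact absurd hij (by simp))).ne'
        have hi : i ≠ Fin.last _ := (lt_of_lt_of_le hij (Fin.le_last j)).ne
        simp only [hj, hi, if_false]
        split_ifs
        · have : Nontrivial (Submodule Λ X) := ⟨_, _, hlt.ne⟩
          exact bot_lt_top
        · exact lt_of_le_of_lt bot_le hlt
        · exact lt_of_lt_of_le hlt le_top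
        · exact hlt
      · have : Fin.last p.length ≠ 0 := by
          rw [Ne, Fin.ext_iff]
          simp
          omega
        simp [this]
    exact_mod_cast hp
  · exact Order.LTSeries.length_le_krullDim (⟨t, c, fun i => hc (Fin.castSucc_lt_succ)⟩ :
      LTSeries (Submodule Λ X))

lemma indec_of_isSimpleModule {Λ : Type u} [Ring Λ] (S : ModuleCat.{u} Λ) [IsSimpleModule Λ S] :
    Indec Λ S := by
  constructor
  · intro h
    have := ModuleCat.subsingleton_of_isZero h
    have := IsSimpleModule.nontrivial Λ S
    exact not_subsingleton S ‹_›
  · rintro A B ⟨e⟩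
    have e' := (e ≪≫ ModuleCat.biprodIsoProd A B).toLinearEquiv
    have h := e'.length_eq
    have h1 : Module.length Λ S = 1 := Module.length_eq_one Λ S
    rw [h1] at h
    have h2 : (1 : ℕ∞) = Module.length Λ A + Module.length Λ B := h.trans (Module.length_prod ..)
    obtain ⟨a, ha⟩ := ENat.ne_top_iff_exists.mp
      (ne_top_of_le_ne_top (ENat.natCast_ne_top 1) (le_self_add.trans h2.ge))
    obtain ⟨b, hb⟩ := ENat.ne_top_iff_exists.mp
      (ne_top_of_le_ne_top (ENat.natCast_ne_top 1) (le_add_self.trans h2.ge))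
    rw [← ha, ← hb] at h2
    norm_cast at h2
    have : a = 0 ∨ b = 0 := by omega
    rcases this with rfl | rfl
    · left
      have := Module.length_eq_zero_iff.mp (ha.symm.trans Nat.cast_zero)
      exact ModuleCat.isZero_of_subsingleton A
    · right
      have := Module.length_eq_zero_iff.mp (hb.symm.trans Nat.cast_zero)
      exact ModuleCat.isZero_of_subsingleton B

namespace NakayamaModel

variable {k : Type u} [Field k] {Λ : Type u} [Ring Λ] [Algebra k Λ] {n m : ℕ}
  (NM : NakayamaModel k Λ n m)

include NM

lemma length_uni (x : ℤ) {t : ℕ} (ht : t ≤ m) : Module.length Λ (NM.uni x t) = t :=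
  (NM.uni_len x t ht).length_eq

lemma chain_uni (x : ℤ) {t : ℕ} (h1 : 1 ≤ t) (ht : t ≤ m)
    (A B : Submodule Λ (NM.uni x t)) : A ≤ B ∨ B ≤ A :=
  NM.base.uniserial _ (NM.uni_indec x t h1 ht).2 (NM.uni_indec x t h1 ht).1 A B

lemma exists_surjective (x : ℤ) {c a : ℕ} (hc : 1 ≤ c) (hca : c ≤ a) (ha : a ≤ m) :
    ∃ g : NM.uni x a →ₗ[Λ] NM.uni x c, Function.Surjective g := by
  rcases eq_or_lt_of_le hca with rfl | h
  · exact ⟨LinearMap.id, Function.surjective_id⟩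
  · obtain ⟨d, rfl⟩ := Nat.exists_eq_add_of_lt h
    obtain ⟨-, g, -, hg, -⟩ := NM.uni_ses x c (d + 1) hc (by omega) (by omega)
    exact ⟨g.hom, (ModuleCat.epi_iff_surjective g).mp hg⟩

lemma exists_injective (y : ℤ) {c b : ℕ} (hc : 1 ≤ c) (hcb : c ≤ b) (hb : b ≤ m) :
    ∃ h : NM.uni (y + (b - c)) c →ₗ[Λ] NM.uni y b, Function.Injective h := by
  rcases eq_or_lt_of_le hcb with rfl | h
  · rw [sub_self, add_zero]
    exact ⟨LinearMap.id, Function.injective_id⟩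
  · obtain ⟨d, rfl⟩ := Nat.exists_eq_add_of_lt h
    obtain ⟨f, -, hf, -, -⟩ := NM.uni_ses y (d + 1) c (by omega) hc (by omega)
    have e : (y + (((c + d + 1 : ℕ) : ℤ) - c)) = y + ((d + 1 : ℕ) : ℤ) := by push_cast; ring
    rw [e, show c + d + 1 = d + 1 + c by omega]
    exact ⟨f.hom, (ModuleCat.mono_iff_injective f).mp hf⟩

lemma nonempty_linearEquiv_of_dvd {x y : ℤ} (h : (n : ℤ) ∣ x - y) (t : ℕ) :
    Nonempty (NM.uni x t ≃ₗ[Λ] NM.uni y t) := by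
  have key : ∀ (z : ℤ) (c : ℕ), Nonempty (NM.uni (z + n * c) t ≃ₗ[Λ] NM.uni z t) := by
    intro z c
    induction c with
    | zero =>
      rw [Nat.cast_zero, mul_zero, add_zero]
      exact ⟨LinearEquiv.refl _ _⟩
    | succ c ih =>
      obtain ⟨e⟩ := ih
      obtain ⟨e'⟩ := NM.uni_per (z + n * c) t
      rw [show z + n * ((c + 1 : ℕ) : ℤ) = z + n * c + n by push_cast; ring]
      exact ⟨e'.toLinearEquiv.trans e⟩
  obtain ⟨d, hd⟩ := h
  obtain ⟨c, rfl | rfl⟩ := Int.eq_nat_or_neg d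
  · rw [show x = y + n * c by linarith]
    exact key y c
  · rw [show y = x + n * c by linarith]
    exact (key x c).map LinearEquiv.symm

lemma dvd_of_linearEquiv_one (hn : 0 < n) {x y : ℤ}
    (h : Nonempty (NM.uni x 1 ≃ₗ[Λ] NM.uni y 1)) : (n : ℤ) ∣ x - y := by
  obtain ⟨S, hS, hinj, -⟩ := NM.base.simples
  have h1 : ∀ i, ∃ z : ℤ, Nonempty (S i ≃ₗ[Λ] NM.uni z 1) := by
    intro i
    have := hS i
    obtain ⟨z, t, -, ht, ⟨e⟩⟩ := NM.uni_all (S i) inferInstance (indec_of_isSimpleModule (S i))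
    have h2 := e.toLinearEquiv.length_eq
    rw [Module.length_eq_one, NM.length_uni z ht] at h2
    have h3 : t = 1 := by exact_mod_cast h2.symm
    subst h3
    exact ⟨z, ⟨e.toLinearEquiv⟩⟩
  choose z hz using h1
  have hn' : (n : ℤ) ≠ 0 := by omega
  have hpos : (0 : ℤ) < n := by omega
  let φ : ℤ → Fin n := fun w => ⟨(w % n).toNat, by
    have := Int.emod_lt_of_pos w hpos
    have := Int.emod_nonneg w hn'
    omega⟩
  have hφ : ∀ w w', φ w = φ w' → (n : ℤ) ∣ w - w' := by
    intro w w' hw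
    have h2 : (w % n).toNat = (w' % n).toNat := congrArg Fin.val hw
    have := Int.emod_nonneg w hn'
    have := Int.emod_nonneg w' hn'
    exact Int.ModEq.dvd (n := (n : ℤ)) (a := w') (b := w) (show w' % n = w % n by omega)
  have hsurj : Function.Surjective (fun i => φ (z i)) := by
    apply Finite.surjective_of_injective
    intro i j hij
    obtain ⟨e⟩ := NM.nonempty_linearEquiv_of_dvd (hφ _ _ hij) 1
    obtain ⟨ei⟩ := hz i
    obtain ⟨ej⟩ := hz j
    exact hinj i j ⟨((ei.trans e).trans ej.symm).toModuleIso⟩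
  obtain ⟨i, hi⟩ := hsurj (φ x)
  obtain ⟨j, hj⟩ := hsurj (φ y)
  obtain ⟨e⟩ := h
  obtain ⟨ei⟩ := hz i
  obtain ⟨ej⟩ := hz j
  obtain ⟨exi⟩ := NM.nonempty_linearEquiv_of_dvd (hφ _ _ hi) 1
  obtain ⟨eyj⟩ := NM.nonempty_linearEquiv_of_dvd (hφ _ _ hj) 1
  have hij : i = j :=
    hinj i j ⟨((((ei.trans exi).trans e).trans eyj.symm).trans ej.symm).toModuleIso⟩
  subst hij
  have := dvd_sub (hφ _ _ hj) (hφ _ _ hi)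
  rwa [show z i - y - (z i - x) = x - y by ring] at this

/-- The image of a nonzero map `π(x,a) → π(y,b)` has top `x` and socle `y + b - 1`. -/
lemma dvd_of_length_range (hn : 0 < n) {x y : ℤ} {a b c : ℕ} (ha1 : 1 ≤ a) (ha : a ≤ m)
    (hb1 : 1 ≤ b) (hb : b ≤ m) (hc : 1 ≤ c) (f : NM.uni x a →ₗ[Λ] NM.uni y b)
    (hf : Module.length Λ (LinearMap.range f) = c) :
    (n : ℤ) ∣ x - (y + (b - c)) := by
  have hcb : c ≤ b := by
    have := Module.length_le_of_injective _ (LinearMap.range f).injective_subtype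
    rw [hf, NM.length_uni y hb] at this
    exact_mod_cast this
  obtain ⟨h, hh⟩ := NM.exists_injective y hc hcb hb
  have hlen : Module.length Λ (LinearMap.range h) = c := by
    rw [← (LinearEquiv.ofInjective h hh).length_eq, NM.length_uni _ (hcb.trans hb)]
  have hfin : Module.length Λ (NM.uni y b) ≠ ⊤ := by
    rw [NM.length_uni y hb]; exact ENat.natCast_ne_top b
  have heq : LinearMap.range f = LinearMap.range h :=
    le_antisymm
      (le_of_length_le_of_chain (NM.chain_uni y hb1 hb) hfin (hf.trans hlen.symm).le)
      (le_of_length_le_of_chain (NM.chain_uni y hb1 hb) hfin (hf.trans hlen.symm).ge)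
  obtain ⟨p, hp⟩ := NM.exists_surjective (y + (b - c)) le_rfl hc (hcb.trans hb)
  obtain ⟨q, hq⟩ := NM.exists_surjective x le_rfl ha1 ha
  let e : LinearMap.range f ≃ₗ[Λ] NM.uni (y + (b - c)) c :=
    (LinearEquiv.ofEq _ _ heq).trans (LinearEquiv.ofInjective h hh).symm
  apply NM.dvd_of_linearEquiv_one hn
  refine nonempty_linearEquiv_of_surjective (NM.chain_uni x ha1 ha) (NM.length_uni x ha) q
    (p ∘ₗ (e.toLinearMap ∘ₗ f.rangeRestrict)) hq
    (hp.comp (e.surjective.comp f.surjective_rangeRestrict)) ?_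
  rw [NM.length_uni _ (hb1.trans hb), NM.length_uni _ (hb1.trans hb)]

lemma exists_length_range {x y : ℤ} {a b c : ℕ} (ha : a ≤ m) (hb : b ≤ m)
    (hc : 1 ≤ c) (hca : c ≤ a) (hcb : c ≤ b) (h : (n : ℤ) ∣ x - (y + (b - c))) :
    ∃ f : NM.uni x a →ₗ[Λ] NM.uni y b, Module.length Λ (LinearMap.range f) = c := by
  obtain ⟨g, hg⟩ := NM.exists_surjective x hc hca ha
  obtain ⟨i, hi⟩ := NM.exists_injective y hc hcb hb
  obtain ⟨e⟩ := NM.nonempty_linearEquiv_of_dvd h c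
  refine ⟨i ∘ₗ (e.toLinearMap ∘ₗ g), ?_⟩
  have h1 : LinearMap.range (i ∘ₗ (e.toLinearMap ∘ₗ g)) = LinearMap.range i :=
    LinearMap.range_comp_of_range_eq_top _
      (LinearMap.range_eq_top.mpr (e.surjective.comp hg))
  rw [h1, ← (LinearEquiv.ofInjective i hi).length_eq, NM.length_uni _ (hcb.trans hb)]

lemma injective_uni (x : ℤ) (hm : 1 ≤ m) : Injective (NM.uni x m) := by
  have := NM.base.selfinj
  have := NM.uni_proj x
  have := (NM.uni_indec x m hm le_rfl).2
  obtain ⟨r, p, hp⟩ := Module.Finite.exists_fin' Λ (NM.uni x m)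
  let e := ModuleCat.biproductIsoPi (fun _ : Fin r => ModuleCat.of Λ Λ)
  let q : (⨁ fun _ : Fin r => ModuleCat.of Λ Λ) ⟶ NM.uni x m := e.hom ≫ ModuleCat.ofHom p
  have hq : Epi q := by
    have : Epi (ModuleCat.ofHom p) := (ModuleCat.epi_iff_surjective _).mpr hp
    exact epi_comp _ _
  refine ⟨fun {X Y} g f hf => ?_⟩
  have hs := Projective.factorThru_comp (𝟙 (NM.uni x m)) q
  refine ⟨Injective.factorThru (g ≫ Projective.factorThru (𝟙 (NM.uni x m)) q) f ≫ q, ?_⟩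
  rw [← Category.assoc, Injective.comp_factorThru, Category.assoc, hs, Category.comp_id]

end NakayamaModel

section Ext

open Abelian

variable {C : Type*} [Category C] [Abelian C] [HasExt.{u} C]

lemma subsingleton_ext_one_iff {S : ShortComplex C} (hS : S.ShortExact) [Projective S.X₂] (Y : C) :
    Subsingleton (Ext S.X₃ Y 1) ↔ ∀ f : S.X₁ ⟶ Y, ∃ F : S.X₂ ⟶ Y, S.f ≫ F = f := by
  constructor
  · intro h f
    obtain ⟨x, hx⟩ := Ext.contravariant_sequence_exact₁ hS Y (Ext.mk₀ f) (add_zero 1)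
      (Subsingleton.elim _ _)
    obtain ⟨F, rfl⟩ := Ext.mk₀_bijective _ _ |>.2 x
    refine ⟨F, (Ext.mk₀_bijective _ _).1 ?_⟩
    rw [← hx, Ext.mk₀_comp_mk₀]
  · intro h
    refine subsingleton_of_forall_eq 0 fun x => ?_
    obtain ⟨z, rfl⟩ := Ext.contravariant_sequence_exact₃ hS Y x
      (Ext.eq_zero_of_projective _) (add_zero 1)
    obtain ⟨f, rfl⟩ := Ext.mk₀_bijective _ _ |>.2 z
    obtain ⟨F, rfl⟩ := h f
    rw [← Ext.mk₀_comp_mk₀, hS.extClass_comp_assoc]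

lemma subsingleton_ext_succ_iff {S : ShortComplex C} (hS : S.ShortExact) [Projective S.X₂] (Y : C)
    (i : ℕ) : Subsingleton (Ext S.X₃ Y (i + 2)) ↔ Subsingleton (Ext S.X₁ Y (i + 1)) := by
  have hi : 1 + (i + 1) = i + 2 := by omega
  constructor
  · intro h
    refine subsingleton_of_forall_eq 0 fun x => ?_
    obtain ⟨z, rfl⟩ := Ext.contravariant_sequence_exact₁ hS Y x hi (Subsingleton.elim _ _)
    rw [Ext.eq_zero_of_projective z, Ext.comp_zero]
  · intro h
    refine subsingleton_of_forall_eq 0 fun x => ?_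
    obtain ⟨z, rfl⟩ := Ext.contravariant_sequence_exact₃ hS Y x
      (Ext.eq_zero_of_projective (n := i + 1) _) hi
    rw [Subsingleton.elim z 0, Ext.comp_zero]

lemma subsingleton_ext_self_of_retract {X Y : C} (h : Retract X Y) {i : ℕ}
    [Subsingleton (Ext Y Y i)] : Subsingleton (Ext X X i) := by
  refine subsingleton_of_forall_eq 0 fun x => ?_
  have h1 : (Ext.mk₀ h.i).comp (((Ext.mk₀ h.r).comp x (zero_add i)).comp (Ext.mk₀ h.i)
      (add_zero i)) (zero_add i) = x.comp (Ext.mk₀ h.i) (add_zero i) := by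
    rw [← Ext.comp_assoc_of_third_deg_zero, Ext.mk₀_comp_mk₀_assoc, h.retract, Ext.mk₀_id_comp]
  rw [Subsingleton.elim (((Ext.mk₀ h.r).comp x (zero_add i)).comp (Ext.mk₀ h.i) (add_zero i)) 0,
    Ext.comp_zero] at h1
  have h2 := congrArg (fun e => e.comp (Ext.mk₀ h.r) (add_zero i)) h1
  simpa [Ext.comp_assoc_of_third_deg_zero] using h2.symm

lemma subsingleton_ext_biprod_left {X₁ X₂ Y : C} {i : ℕ} (h₁ : Subsingleton (Ext X₁ Y i))
    (h₂ : Subsingleton (Ext X₂ Y i)) : Subsingleton (Ext (X₁ ⊞ X₂) Y i) :=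
  Ext.biprodAddEquiv.toEquiv.subsingleton

lemma subsingleton_ext_biprod_right {X Y₁ Y₂ : C} {i : ℕ} (h₁ : Subsingleton (Ext X Y₁ i))
    (h₂ : Subsingleton (Ext X Y₂ i)) : Subsingleton (Ext X (Y₁ ⊞ Y₂) i) :=
  Ext.addEquivBiprod.toEquiv.subsingleton

lemma subsingleton_ext_biproduct_left {J : Type*} [Fintype J] (X : J → C) [HasBiproduct X] {Y : C}
    {i : ℕ} (h : ∀ j, Subsingleton (Ext (X j) Y i)) : Subsingleton (Ext (⨁ X) Y i) :=
  (Ext.biproductAddEquiv (biproduct.isBilimit X) Y i).toEquiv.subsingleton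

lemma subsingleton_ext_biproduct_right {J : Type*} [Fintype J] {X : C} (Y : J → C) [HasBiproduct Y]
    {i : ℕ} (h : ∀ j, Subsingleton (Ext X (Y j) i)) : Subsingleton (Ext X (⨁ Y) i) :=
  (Ext.addEquivBiproduct X (biproduct.isBilimit Y) i).toEquiv.subsingleton

end Ext

namespace NakayamaModel

open Abelian

variable {k : Type u} [Field k] {Λ : Type u} [Ring Λ] [Algebra k Λ] {n m : ℕ}
  (NM : NakayamaModel k Λ n m)

include NM

lemma exists_shortExact (x : ℤ) {a : ℕ} (ha1 : 1 ≤ a) (ha : a < m) :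
    ∃ (f : NM.uni (x + a) (m - a) ⟶ NM.uni x m) (g : NM.uni x m ⟶ NM.uni x a) (w : f ≫ g = 0),
      (ShortComplex.mk f g w).ShortExact := by
  obtain ⟨f, g, hf, hg, w, h⟩ := NM.uni_ses x a (m - a) ha1 (by omega) (by omega)
  have e : a + (m - a) = m := by omega
  have key : ∃ (f : NM.uni (x + a) (m - a) ⟶ NM.uni x (a + (m - a)))
      (g : NM.uni x (a + (m - a)) ⟶ NM.uni x a) (w : f ≫ g = 0),
      (ShortComplex.mk f g w).ShortExact := ⟨f, g, w, { exact := h }⟩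
  rwa [e] at key

variable [HasExt.{u} (ModuleCat.{u} Λ)]

lemma subsingleton_ext_one_iff (hn : 0 < n) {x y : ℤ} {a b : ℕ} (ha1 : 1 ≤ a) (ha : a < m)
    (hb1 : 1 ≤ b) (hb : b ≤ m) :
    Subsingleton (Ext (NM.uni x a) (NM.uni y b) 1) ↔
      ∀ l : ℕ, 1 ≤ l → l + a ≤ m → l ≤ b → (n : ℤ) ∣ (x + a) - (y + (b - l)) → l + a ≤ b := by
  obtain ⟨ι, π, w, hS⟩ := NM.exists_shortExact x ha1 ha
  have hP : Projective (ShortComplex.mk ι π w).X₂ := NM.uni_proj x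
  have hι : Function.Injective ι.hom := (ModuleCat.mono_iff_injective ι).mp hS.mono_f
  have hma : m - a ≤ m := Nat.sub_le m a
  have hlen : Module.length Λ (NM.uni x m) = (a + (m - a) : ℕ) := by
    rw [NM.length_uni x le_rfl, Nat.add_sub_cancel' ha.le]
  have hchain := NM.chain_uni x (ha1.trans ha.le) le_rfl
  refine (Rigidity.subsingleton_ext_one_iff hS (NM.uni y b)).trans ⟨?_, ?_⟩
  · intro h l hl1 hla hlb hdvd
    obtain ⟨f, hf⟩ := NM.exists_length_range hma hb hl1 (by omega) hlb hdvd
    obtain ⟨F, hF⟩ := h (ModuleCat.ofHom f)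
    have hF' : F.hom ∘ₗ ι.hom = f := congrArg ModuleCat.Hom.hom hF
    have h0 : F.hom ∘ₗ ι.hom ≠ 0 := by
      rw [hF']
      rintro rfl
      rw [LinearMap.range_zero, Module.length_bot] at hf
      have : l = 0 := by exact_mod_cast hf.symm
      omega
    have h1 := length_range_eq_of_comp_ne_zero hchain (NM.length_uni _ hma) hlen ι.hom hι F.hom h0
    have h2 := Module.length_le_of_injective _ (LinearMap.range F.hom).injective_subtype
    rw [h1, hF', hf, NM.length_uni y hb] at h2
    norm_cast at h2
    omega
  · intro h f
    by_cases hf0 : f = 0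
    · exact ⟨0, by rw [hf0, comp_zero]⟩
    have hinj := NM.injective_uni (y + (b - m)) (ha1.trans ha.le)
    obtain ⟨j, hj⟩ : ∃ j : NM.uni y b →ₗ[Λ] NM.uni (y + (b - m)) m, Function.Injective j := by
      have := NM.exists_injective (y + (b - m)) hb1 hb le_rfl
      rwa [show y + ((b : ℤ) - m) + (m - b) = y by ring] at this
    have hmono : Mono ι := hS.mono_f
    let F₀ : NM.uni x m ⟶ NM.uni (y + (b - m)) m := Injective.factorThru (f ≫ ModuleCat.ofHom j) ι
    have hF₀ : ι ≫ F₀ = f ≫ ModuleCat.ofHom j := Injective.comp_factorThru _ _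
    have hF₀' : F₀.hom ∘ₗ ι.hom = j ∘ₗ f.hom := congrArg ModuleCat.Hom.hom hF₀
    have hf0' : f.hom ≠ 0 := fun h0 => hf0 (ModuleCat.hom_ext h0)
    have h0 : F₀.hom ∘ₗ ι.hom ≠ 0 := by
      rw [hF₀']
      intro h0
      apply hf0'
      ext z
      exact hj ((LinearMap.congr_fun h0 z).trans (map_zero j).symm)
    obtain ⟨l, hl, hlm⟩ := exists_length_eq_of_le (NM.length_uni (x + a) hma)
      (Module.length_le_of_surjective _ f.hom.surjective_rangeRestrict)
    have hlb := Module.length_le_of_injective _ (LinearMap.range f.hom).injective_subtype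
    rw [hl, NM.length_uni y hb] at hlb
    have hlb : l ≤ b := by exact_mod_cast hlb
    have hl1 : 1 ≤ l := by
      by_contra hl0
      obtain rfl : l = 0 := by omega
      have := Module.length_eq_zero_iff.mp (hl.trans Nat.cast_zero)
      exact hf0' (LinearMap.range_eq_bot.mp ((Submodule.subsingleton_iff_eq_bot).mp this))
    have hab := h l hl1 (by omega) hlb
      (NM.dvd_of_length_range hn (by omega) hma hb1 hb hl1 f.hom hl)
    have h1 := length_range_eq_of_comp_ne_zero hchain (NM.length_uni _ hma) hlen ι.hom hι F₀.hom h0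
    have h2 : Module.length Λ (LinearMap.range (F₀.hom ∘ₗ ι.hom)) = l := by
      rw [hF₀', LinearMap.range_comp, ← hl]
      exact ((LinearMap.range f.hom).equivMapOfInjective j hj).length_eq.symm
    have hle : LinearMap.range F₀.hom ≤ LinearMap.range j := by
      apply le_of_length_le_of_chain (NM.chain_uni _ (ha1.trans ha.le) le_rfl)
      · rw [NM.length_uni _ le_rfl]
        exact ENat.natCast_ne_top m
      · rw [h1, h2, ← (LinearEquiv.ofInjective j hj).length_eq, NM.length_uni y hb]
        norm_cast
        omega
    let G : NM.uni x m →ₗ[Λ] LinearMap.range j :=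
      F₀.hom.codRestrict _ fun z => hle (LinearMap.mem_range_self _ z)
    refine ⟨ModuleCat.ofHom ((LinearEquiv.ofInjective j hj).symm.toLinearMap ∘ₗ G), ?_⟩
    ext z
    apply hj
    have h3 : j ((LinearEquiv.ofInjective j hj).symm (G (ι.hom z))) = (G (ι.hom z) : NM.uni _ m) :=
      congrArg Subtype.val ((LinearEquiv.ofInjective j hj).apply_symm_apply (G (ι.hom z)))
    exact h3.trans (LinearMap.congr_fun hF₀' z)

lemma subsingleton_ext_succ_iff (x : ℤ) {a : ℕ} (ha1 : 1 ≤ a) (ha : a < m) (Y : ModuleCat.{u} Λ)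
    (i : ℕ) : Subsingleton (Ext (NM.uni x a) Y (i + 2)) ↔
      Subsingleton (Ext (NM.uni (x + a) (m - a)) Y (i + 1)) := by
  obtain ⟨ι, π, w, hS⟩ := NM.exists_shortExact x ha1 ha
  have hP : Projective (ShortComplex.mk ι π w).X₂ := NM.uni_proj x
  exact Rigidity.subsingleton_ext_succ_iff hS Y i

lemma subsingleton_ext_odd_iff (x : ℤ) {a : ℕ} (ha1 : 1 ≤ a) (ha : a < m) (Y : ModuleCat.{u} Λ)
    (q : ℕ) : Subsingleton (Ext (NM.uni x a) Y (2 * q + 1)) ↔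
      Subsingleton (Ext (NM.uni (x + q * m) a) Y 1) := by
  induction q generalizing x with
  | zero => simp
  | succ q ih =>
    have e := NM.subsingleton_ext_succ_iff x ha1 ha Y (2 * q + 1)
    have e' := NM.subsingleton_ext_succ_iff (x + a) (a := m - a) (by omega) (by omega) Y (2 * q)
    rw [Nat.sub_sub_self ha.le, Nat.cast_sub ha.le, add_add_sub_cancel] at e'
    refine (e.trans e').trans ?_
    rw [ih, show x + m + q * (m : ℤ) = x + ((q + 1 : ℕ) : ℤ) * m by push_cast; ring]

lemma subsingleton_ext_even_iff (x : ℤ) {a : ℕ} (ha1 : 1 ≤ a) (ha : a < m) (Y : ModuleCat.{u} Λ)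
    (q : ℕ) : Subsingleton (Ext (NM.uni x a) Y (2 * q + 2)) ↔
      Subsingleton (Ext (NM.uni (x + a + q * m) (m - a)) Y 1) :=
  (NM.subsingleton_ext_succ_iff x ha1 ha Y (2 * q)).trans
    (NM.subsingleton_ext_odd_iff (x + a) (by omega) (by omega) Y q)


/-- The rigidity of `π(0,t)` in a fixed degree propagates to all summands `π(0,z)` with
`1 ≤ z ≤ t` and `π(-j, δ+t+j)` with `0 ≤ j < m - δ - t`. -/
lemma subsingleton_ext_of_self (hn : 0 < n) {δ t : ℕ} (hδ : (n : ℤ) ∣ δ) (ht0 : 0 < t)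
    (hlo : m ≤ δ + 2 * t) (ht2 : 2 * t ≤ m) (i : ℕ)
    (h : Subsingleton (Ext (NM.uni 0 t) (NM.uni 0 t) (i + 1))) {x y : ℤ} {a b : ℕ}
    (hx : (x = 0 ∧ 1 ≤ a ∧ a ≤ t) ∨ ∃ j : ℕ, δ + t + j < m ∧ x = -j ∧ a = δ + t + j)
    (hy : (y = 0 ∧ 1 ≤ b ∧ b ≤ t) ∨ ∃ j : ℕ, δ + t + j < m ∧ y = -j ∧ b = δ + t + j) :
    Subsingleton (Ext (NM.uni x a) (NM.uni y b) (i + 1)) := by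
  obtain ⟨ha1, ha⟩ : 1 ≤ a ∧ a < m := by
    rcases hx with ⟨-, h1, h2⟩ | ⟨j, hj, -, rfl⟩ <;> omega
  obtain ⟨hb1, hb⟩ : 1 ≤ b ∧ b < m := by
    rcases hy with ⟨-, h1, h2⟩ | ⟨j, hj, -, rfl⟩ <;> omega
  obtain ⟨q, rfl | rfl⟩ := Nat.even_or_odd' i
  · rw [NM.subsingleton_ext_odd_iff _ ht0 (by omega),
      NM.subsingleton_ext_one_iff hn ht0 (by omega) ht0 (by omega)] at h
    rw [NM.subsingleton_ext_odd_iff _ ha1 ha, NM.subsingleton_ext_one_iff hn ha1 ha hb1 hb.le]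
    have h' : ∀ z : ℤ, 1 ≤ z → z ≤ t → ¬ (n : ℤ) ∣ q * m + z := by
      intro z hz1 hz hd
      lift z to ℕ using by omega
      have := h z (by omega) (by omega) (by omega) (by convert hd using 1; ring)
      omega
    intro l hl1 hlm hlb hd
    by_contra hlt
    rcases hx with ⟨rfl, -, hat⟩ | ⟨j, hj, rfl, rfl⟩ <;>
      rcases hy with ⟨rfl, -, hbt⟩ | ⟨j', hj', rfl, rfl⟩
    · exact h' (l + a - b) (by omega) (by omega) (by convert hd using 1; ring)
    · exact h' (l + a - (δ + t)) (by omega) (by omega) (by convert hd using 1; push_cast; ring)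
    · exact h' (l + t - b) (by omega) (by omega)
        (by convert Int.dvd_sub hd hδ using 1; push_cast; ring)
    · exact h' l (by omega) (by omega) (by convert hd using 1; push_cast; ring)
  · rw [NM.subsingleton_ext_even_iff _ ht0 (by omega),
      NM.subsingleton_ext_one_iff hn (by omega) (by omega) ht0 (by omega),
      Nat.cast_sub (by omega)] at h
    rw [NM.subsingleton_ext_even_iff _ ha1 ha,
      NM.subsingleton_ext_one_iff hn (by omega) (by omega) hb1 hb.le, Nat.cast_sub ha.le]
    have h' : ∀ z : ℤ, 1 ≤ z → z ≤ t → ¬ (n : ℤ) ∣ q * m + m - t + z := by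
      intro z hz1 hz hd
      lift z to ℕ using by omega
      have := h z (by omega) (by omega) (by omega) (by convert hd using 1; ring)
      omega
    intro l hl1 hlm hlb hd
    by_contra hlt
    rcases hx with ⟨rfl, -, hat⟩ | ⟨j, hj, rfl, rfl⟩ <;>
      rcases hy with ⟨rfl, -, hbt⟩ | ⟨j', hj', rfl, rfl⟩
    · exact h' (l + t - b) (by omega) (by omega) (by convert hd using 1; ring)
    · exact h' l (by omega) (by omega) (by convert Int.dvd_add hd hδ using 1; push_cast; ring)
    · exact h' (l + t - b - j) (by omega) (by omega) (by convert hd using 1; push_cast; ring)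
    · exact h' (l - j - δ) (by omega) (by omega) (by convert hd using 1; push_cast; ring)

end NakayamaModel

/-- Proposition `prop-rdNtdelta`: for `Λ = A_{n,m}` with `m > n`,
`δ = max{n, (k₀-1)n}` and `0 ≤ m - δ - t ≤ t ≤ m/2`, the generator-cogenerator
`N = Λ ⊕ L ⊕ T` with `L = ⊕_{1 ≤ z ≤ t} π(0,z)` and
`T = ⊕_{0 ≤ j ≤ m-1-δ-t} π(-j, δ+t+j)` satisfies `rd(N) = rd(π(0,t))`. -/
theorem statement17 (k : Type u) [Field k] (Λ : Type u) [Ring Λ] [Algebra k Λ]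
    (n m : ℕ) (hn : 0 < n) (hnm : n < m)
    (NM : NakayamaModel k Λ n m)
    [HasExt.{u} (ModuleCat.{u} Λ)]
    (k0 s1 : ℕ) (hm : m = k0 * n + s1) (hs1 : s1 < n)
    (δ : ℕ) (hδ : δ = max n ((k0 - 1) * n))
    (t : ℕ) (ht0 : 0 < t) (hδt : δ + t ≤ m) (hlo : m - δ - t ≤ t) (ht2 : 2 * t ≤ m) :
    rigDeg Λ ((ModuleCat.of Λ Λ) ⊞
        ((⨁ fun i : Fin t => NM.uni 0 ((i : ℕ) + 1)) ⊞
          (⨁ fun j : Fin (m - δ - t) => NM.uni (-((j : ℕ) : ℤ)) (δ + t + (j : ℕ))))) =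
      rigDeg Λ (NM.uni 0 t) := by
  have hδn : (n : ℤ) ∣ δ := by
    rw [hδ]
    rcases max_choice n ((k0 - 1) * n) with h | h <;> rw [h]
    exact_mod_cast dvd_mul_left n (k0 - 1)
  have hlo' : m ≤ δ + 2 * t := by omega
  have key : ∀ i : ℕ, Subsingleton (Abelian.Ext (NM.uni 0 t) (NM.uni 0 t) (i + 1)) →
      ∀ {x y : ℤ} {a b : ℕ},
      ((x = 0 ∧ 1 ≤ a ∧ a ≤ t) ∨ ∃ j : ℕ, δ + t + j < m ∧ x = -j ∧ a = δ + t + j) →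
      ((y = 0 ∧ 1 ≤ b ∧ b ≤ t) ∨ ∃ j : ℕ, δ + t + j < m ∧ y = -j ∧ b = δ + t + j) →
      Subsingleton (Abelian.Ext (NM.uni x a) (NM.uni y b) (i + 1)) :=
    fun i h _ _ _ _ hx hy =>
      NM.subsingleton_ext_of_self hn hδn ht0 hlo' ht2 i h hx hy
  have hinj : Injective (ModuleCat.of Λ Λ) := NM.base.selfinj
  have hproj : Projective (ModuleCat.of Λ Λ) := (IsProjective.iff_projective _).mp inferInstance
  unfold rigDeg
  congr 1
  ext c
  refine exists_congr fun r => and_congr_right fun _ => and_congr_right fun _ =>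
    forall_congr' fun i => imp_congr_right fun hi => imp_congr_right fun _ => ⟨fun h => ?_, ?_⟩
  · have hs : ∀ s : Fin t, Subsingleton
        (Abelian.Ext (NM.uni 0 ((s : ℕ) + 1)) (NM.uni 0 ((s : ℕ) + 1)) i) := fun s =>
      subsingleton_ext_self_of_retract (Y := ModuleCat.of Λ Λ ⊞
          ((⨁ fun i : Fin t => NM.uni 0 ((i : ℕ) + 1)) ⊞
            (⨁ fun j : Fin (m - δ - t) => NM.uni (-((j : ℕ) : ℤ)) (δ + t + (j : ℕ)))))
        { i := biproduct.ι (fun i : Fin t => NM.uni 0 ((i : ℕ) + 1)) s ≫ biprod.inl ≫ biprod.inr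
          r := biprod.snd ≫ biprod.fst ≫ biproduct.π _ s
          retract := by simp }
    have := hs ⟨t - 1, by omega⟩
    rwa [show ((⟨t - 1, by omega⟩ : Fin t) : ℕ) + 1 = t from Nat.sub_add_cancel ht0] at this
  · obtain ⟨i, rfl⟩ := Nat.exists_eq_add_of_le' hi
    intro h
    have hL : ∀ s : Fin t, ((0 : ℤ) = 0 ∧ 1 ≤ (s : ℕ) + 1 ∧ (s : ℕ) + 1 ≤ t) ∨
        ∃ j : ℕ, δ + t + j < m ∧ (0 : ℤ) = -j ∧ (s : ℕ) + 1 = δ + t + j :=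
      fun s => Or.inl ⟨rfl, by omega, s.isLt⟩
    have hT : ∀ s : Fin (m - δ - t), (-((s : ℕ) : ℤ) = 0 ∧ 1 ≤ δ + t + s ∧ δ + t + (s : ℕ) ≤ t) ∨
        ∃ j : ℕ, δ + t + j < m ∧ -((s : ℕ) : ℤ) = -j ∧ δ + t + (s : ℕ) = δ + t + j :=
      fun s => Or.inr ⟨s, by omega, rfl, rfl⟩
    apply subsingleton_ext_biprod_left (Abelian.Ext.subsingleton_of_projective _ _ _)
    apply subsingleton_ext_biprod_right (Abelian.Ext.subsingleton_of_injective _ _ _)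
    apply subsingleton_ext_biprod_left <;> apply subsingleton_ext_biproduct_left <;> intro s <;>
      apply subsingleton_ext_biprod_right <;> apply subsingleton_ext_biproduct_right <;> intro s'
    · exact key i h (hL s) (hL s')
    · exact key i h (hL s) (hT s')
    · exact key i h (hT s) (hL s')
    · exact key i h (hT s) (hT s')

end Rigidity
end
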